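/- arXiv:2504.18862 — 4 statements merged into one kernel-verified Lean document; each statement's English description precedes it below -/
import Mathlib

section
/- For every integer k ≥ 3 there exists a constant C_k > 0 such that for all positive integers n₁,…,n_k and every tuple i = (i₁,…,i_{k−1}) ∈ {0,1}^{k−1}, if α(n;i) ≠ 0 then |α(n;i)| ≥ C_k · (max(n₁,…,n_k))^{−(4^{k−2} − 1/4)}. -/
open Real Finset

/-- `α(n; i) = n₁^{1/4} + (−1)^{i₁} n₂^{1/4} + ⋯ + (−1)^{i_{k−1}} n_k^{1/4}`, encoded with a sign
bit for every index; the leading `+1` sign corresponds to the hypothesis `i 0 = false`. -/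
noncomputable def alphaRS {k : ℕ} (n : Fin k → ℕ) (i : Fin k → Bool) : ℝ :=
  ∑ j, (if i j then (-1 : ℝ) else 1) * (n j : ℝ) ^ ((1 : ℝ) / 4)

open Polynomial in
/-- The product of a polynomial with its reflection is a polynomial in the square. -/
theorem exists_comp_X_sq_eq_mul_comp_neg_X {R : Type*} [CommRing R] (p : R[X]) :
    ∃ q : R[X], q.comp (X ^ 2) = p * p.comp (-X) := by
  have split : ∃ a b : R[X], p = a.comp (X ^ 2) + X * b.comp (X ^ 2) := by
    induction p using Polynomial.induction_on' with
    | add p q hp hq =>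
      obtain ⟨a, b, rfl⟩ := hp
      obtain ⟨c, d, rfl⟩ := hq
      exact ⟨a + c, b + d, by simp only [add_comp]; ring⟩
    | monomial n r =>
      obtain ⟨m, rfl | rfl⟩ := n.even_or_odd'
      · exact ⟨C r * X ^ m, 0, by simp [← C_mul_X_pow_eq_monomial, ← pow_mul]⟩
      · refine ⟨0, C r * X ^ m, ?_⟩
        simp [← C_mul_X_pow_eq_monomial, ← pow_mul]
        ring
  obtain ⟨a, b, rfl⟩ := split
  refine ⟨a ^ 2 - X * b ^ 2, ?_⟩
  simp only [sub_comp, pow_comp, mul_comp, X_comp, add_comp, comp_assoc, neg_sq]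
  ring

open Polynomial in
/-- Translating an integer polynomial by all fourth roots of an integer and multiplying the
results gives an integer polynomial. -/
theorem exists_map_eq_prod_comp_fourth_roots (p : ℤ[X]) (x : ℂ) (n : ℤ) (hx : x ^ 4 = n) :
    ∃ q : ℤ[X], q.map (Int.castRingHom ℂ) =
      ∏ u : Fin 4, (p.map (Int.castRingHom ℂ)).comp (X + C (Complex.I ^ (u : ℕ) * x)) := by
  set P : ℤ[X][X] := (p.map C).comp (C X + X)
  obtain ⟨Q, hQ⟩ := exists_comp_X_sq_eq_mul_comp_neg_X P
  obtain ⟨T, hT⟩ := exists_comp_X_sq_eq_mul_comp_neg_X Q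
  set φ : ℤ[X] →+* ℂ[X] := mapRingHom (Int.castRingHom ℂ)
  have eP (s : ℂ[X]) : P.eval₂ φ s = (p.map (Int.castRingHom ℂ)).comp (X + s) := by
    change (eval₂RingHom φ s) (eval₂ C (C X + X) (p.map C)) = _
    rw [eval₂_map, hom_eval₂, comp, eval₂_map]
    congr 1
    · exact RingHom.ext_int _ _
    · simp [φ]
  have eQ (s : ℂ[X]) : Q.eval₂ φ (s ^ 2) = P.eval₂ φ s * P.eval₂ φ (-s) := by
    have h := congrArg (eval₂ φ s) hQ
    simpa only [eval₂_mul, eval₂_comp, eval₂_pow, eval₂_X, eval₂_neg] using h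
  have eT (s : ℂ[X]) : T.eval₂ φ (s ^ 2) = Q.eval₂ φ s * Q.eval₂ φ (-s) := by
    have h := congrArg (eval₂ φ s) hT
    simpa only [eval₂_mul, eval₂_comp, eval₂_pow, eval₂_X, eval₂_neg] using h
  refine ⟨T.eval (C n), ?_⟩
  have hn : φ (C n) = (C x ^ 2) ^ 2 := by
    rw [← pow_mul, ← C_pow, hx]
    simp [φ]
  have hI : -(C x ^ 2 : ℂ[X]) = C (Complex.I * x) ^ 2 := by
    rw [← C_pow, ← C_pow, mul_pow, Complex.I_sq]
    simp
  change φ (T.eval (C n)) = _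
  rw [← eval₂_hom, hn, eT, hI, eQ, eQ]
  simp only [eP, Fin.prod_univ_four]
  simp [pow_succ]
  ring

open Polynomial in
theorem exists_map_eq_prod_X_add_sum_fourth_roots {k : ℕ} (x : Fin k → ℂ) (n : Fin k → ℤ)
    (hx : ∀ j, x j ^ 4 = n j) :
    ∃ q : ℤ[X], q.map (Int.castRingHom ℂ) =
      ∏ w : Fin k → Fin 4, (X + C (∑ j, Complex.I ^ (w j : ℕ) * x j)) := by
  induction k with
  | zero => exact ⟨X, by simp⟩
  | succ k ih =>
    obtain ⟨p, hp⟩ := ih (fun j => x j.succ) (fun j => n j.succ) (fun j => hx _)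
    obtain ⟨q, hq⟩ := exists_map_eq_prod_comp_fourth_roots p (x 0) (n 0) (hx 0)
    refine ⟨q, ?_⟩
    rw [hq, hp, ← (Fin.consEquiv fun _ => Fin 4).prod_comp, Fintype.prod_prod_type]
    refine Finset.prod_congr rfl fun u _ => ?_
    rw [Polynomial.prod_comp]
    refine Finset.prod_congr rfl fun w _ => ?_
    simp [Fin.consEquiv, Fin.sum_univ_succ, add_assoc]

open Polynomial in
/-- The nonzero roots, with multiplicity, of a monic split integer polynomial have product of
absolute value at least one. -/
theorem one_le_prod_norm_of_map_eq_prod {ι : Type*} [Fintype ι] (f : ι → ℂ) (q : ℤ[X])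
    (hq : q.map (Int.castRingHom ℂ) = ∏ a, (X + C (f a))) :
    1 ≤ ∏ a with f a ≠ 0, ‖f a‖ := by
  have hsplit : ∏ a, (X + C (f a)) =
      (∏ a with f a ≠ 0, (X + C (f a))) * X ^ #{a | ¬ f a ≠ 0} := by
    rw [← Finset.prod_filter_mul_prod_filter_not _ fun a => f a ≠ 0]
    congr 1
    rw [← Finset.prod_const]
    refine Finset.prod_congr rfl fun a ha => ?_
    simp [not_not.mp (Finset.mem_filter.mp ha).2]
  have hcoeff : (q.coeff #{a | ¬ f a ≠ 0} : ℂ) = ∏ a with f a ≠ 0, f a := by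
    have h := congrArg (fun r => coeff r #{a | ¬ f a ≠ 0}) (hq.trans hsplit)
    simpa [coeff_mul_X_pow', coeff_zero_eq_eval_zero, eval_prod] using h
  rw [← norm_prod, ← hcoeff, Complex.norm_intCast, ← Int.cast_abs]
  have hne : q.coeff #{a | ¬ f a ≠ 0} ≠ 0 := by
    rw [← Int.cast_ne_zero (α := ℂ), hcoeff]
    exact Finset.prod_ne_zero_iff.mpr fun a ha => (Finset.mem_filter.mp ha).2
  exact_mod_cast Int.one_le_abs hne

/-- A nonvanishing sum of fourth roots of integers, each of size at most `b`, is bounded below. -/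
theorem one_le_norm_sum_fourth_roots_mul {k : ℕ} (hk : 0 < k) (x : Fin k → ℂ) (n : Fin k → ℤ)
    (hx : ∀ j, x j ^ 4 = n j) {b : ℝ} (hb : ∀ j, ‖x j‖ ≤ b) (hkb : 1 ≤ k * b)
    (w : Fin k → Fin 4) (hw : ∑ j, Complex.I ^ (w j : ℕ) * x j ≠ 0) :
    1 ≤ ‖∑ j, Complex.I ^ (w j : ℕ) * x j‖ * (k * b) ^ (4 ^ (k - 1) - 1) := by
  obtain ⟨q, hq⟩ := exists_map_eq_prod_X_add_sum_fourth_roots x n hx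
  have hprod := one_le_prod_norm_of_map_eq_prod _ q hq
  set f : (Fin k → Fin 4) → ℂ := fun v => ∑ j, Complex.I ^ (v j : ℕ) * x j with hf
  change 1 ≤ ‖f w‖ * _
  have hle (v) : ‖f v‖ ≤ k * b := by
    refine (norm_sum_le _ _).trans ?_
    simpa using Finset.sum_le_card_nsmul Finset.univ (fun j => ‖Complex.I ^ (v j : ℕ) * x j‖) b
      (by simpa using hb)
  have hpow (a c : Fin 4) :
      Complex.I ^ ((a + c : Fin 4) : ℕ) = Complex.I ^ (a : ℕ) * Complex.I ^ (c : ℕ) := by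
    rw [Fin.val_add, ← pow_add, ← Complex.I_pow_eq_pow_mod]
  have hrot (u : Fin 4) : f (fun j => u + w j) = Complex.I ^ (u : ℕ) * f w := by
    simp only [hf, hpow, Finset.mul_sum, mul_assoc]
  let e : Fin 4 ↪ (Fin k → Fin 4) :=
    ⟨fun u j => u + w j, fun u v h => add_right_cancel (congrFun h ⟨0, hk⟩)⟩
  set S := Finset.univ.map e
  have hS : S ⊆ ({v | f v ≠ 0} : Finset _) := by
    intro v hv
    obtain ⟨u, -, rfl⟩ := Finset.mem_map.mp hv
    have : f (e u) = _ := hrot u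
    simpa [this] using hw
  have hSprod : ∏ v ∈ S, ‖f v‖ = ‖f w‖ ^ 4 := by
    rw [Finset.prod_map]
    have (u : Fin 4) : ‖f (e u)‖ = ‖f w‖ := by
      have : f (e u) = _ := hrot u
      simp [this]
    simp [this]
  have hcard : #(({v | f v ≠ 0} : Finset _) \ S) ≤ (4 ^ (k - 1) - 1) * 4 := by
    have h1 : #(({v | f v ≠ 0} : Finset (Fin k → Fin 4)) \ S) ≤ #(Finset.univ \ S) :=
      Finset.card_le_card (Finset.sdiff_subset_sdiff (Finset.subset_univ _) le_rfl)
    rw [Finset.card_sdiff_of_subset (Finset.subset_univ _)] at h1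
    simp only [S, Finset.card_map, Finset.card_univ, Fintype.card_fun, Fintype.card_fin] at h1
    rwa [Nat.sub_mul, ← pow_succ, Nat.sub_add_cancel hk, one_mul]
  have hrest : ∏ v ∈ ({v | f v ≠ 0} : Finset _) \ S, ‖f v‖ ≤ (k * b) ^ ((4 ^ (k - 1) - 1) * 4) := by
    refine (Finset.prod_le_prod (fun v _ => norm_nonneg _) fun v _ => hle v).trans ?_
    rw [Finset.prod_const]
    exact pow_le_pow_right₀ hkb hcard
  rw [← Finset.prod_sdiff hS, hSprod] at hprod
  have h4 : 1 ≤ (‖f w‖ * (k * b) ^ (4 ^ (k - 1) - 1)) ^ 4 := by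
    rw [mul_pow, ← pow_mul, mul_comm]
    exact hprod.trans (by gcongr)
  exact (one_le_pow_iff_of_nonneg (by positivity) (by norm_num)).mp h4

theorem stmt_0 (k : ℕ) (hk : 3 ≤ k) :
    ∃ C : ℝ, 0 < C ∧ ∀ (n : Fin k → ℕ) (i : Fin k → Bool),
      (∀ j, 0 < n j) → i ⟨0, by omega⟩ = false → alphaRS n i ≠ 0 →
      C * ((Finset.univ.sup n : ℕ) : ℝ) ^ (-((4 : ℝ) ^ (k - 2) - 1 / 4)) ≤ |alphaRS n i| := by

  have hk0 : (0 : ℝ) < k := by exact_mod_cast (by omega : 0 < k)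
  refine ⟨((k : ℝ) ^ (4 ^ (k - 1) - 1))⁻¹, by positivity, fun n i hn _ hα => ?_⟩
  set M := Finset.univ.sup n
  set b : ℝ := (M : ℝ) ^ ((1 : ℝ) / 4) with hbdef
  have hnM (j) : n j ≤ M := Finset.le_sup (Finset.mem_univ j)
  have hM : 1 ≤ M := (hn ⟨0, by omega⟩).trans_le (hnM _)
  have hM' : (1 : ℝ) ≤ M := by exact_mod_cast hM
  have hb1 : 1 ≤ b := Real.one_le_rpow hM' (by norm_num)
  have hkb : 1 ≤ k * b :=
    one_le_mul_of_one_le_of_one_le (by exact_mod_cast (by omega : 1 ≤ k)) hb1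
  have hα' : ∑ j, Complex.I ^ ((if i j then 2 else 0 : Fin 4) : ℕ) *
      (((n j : ℝ) ^ ((1 : ℝ) / 4) : ℝ) : ℂ) = (alphaRS n i : ℂ) := by
    rw [alphaRS, Complex.ofReal_sum]
    refine Finset.sum_congr rfl fun j _ => ?_
    cases i j <;> simp
  have key := one_le_norm_sum_fourth_roots_mul (k := k) (by omega)
    (fun j => (((n j : ℝ) ^ ((1 : ℝ) / 4) : ℝ) : ℂ)) (fun j => n j)
    (fun j => by
      rw [← Complex.ofReal_pow, ← Real.rpow_natCast, ← Real.rpow_mul (by positivity)]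
      norm_num) (b := b)
    (fun j => by
      rw [Complex.norm_of_nonneg (by positivity)]
      exact Real.rpow_le_rpow (by positivity) (by exact_mod_cast hnM j) (by norm_num))
    hkb (fun j => if i j then 2 else 0) (by rw [hα']; exact_mod_cast hα)
  rw [hα', Complex.norm_real, Real.norm_eq_abs] at key
  have hexp : (M : ℝ) ^ (-((4 : ℝ) ^ (k - 2) - 1 / 4)) = (b ^ (4 ^ (k - 1) - 1))⁻¹ := by
    rw [Real.rpow_neg (by positivity), hbdef, ← Real.rpow_natCast _ (4 ^ (k - 1) - 1),
      ← Real.rpow_mul (by positivity), Nat.cast_sub (Nat.one_le_pow _ _ (by norm_num)),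
      show k - 1 = k - 2 + 1 by omega]
    push_cast
    congr 2
    ring
  rw [hexp, ← mul_inv, ← mul_pow]
  exact (inv_le_iff_one_le_mul₀ (by positivity)).mpr key
end

section
/- Let k ≥ 3 be an integer, let i = (i₁,…,i_{k−1}) ∈ {0,1}^{k−1} with i ≠ (0,…,0), let N₁,…,N_k > 1 be real numbers, set H = max(N₁,…,N_k), and let 0 < Δ ≤ H^{1/4}. Let A denote the number of k-tuples (n₁,…,n_k) of positive integers with N_j < n_j ≤ 2N_j for 1 ≤ j ≤ k satisfying |α(n;i)| < Δ. Then there is a constant C_k > 0 depending only on k such that A ≤ C_k (Δ H^{−1/4} N₁⋯N_k + H^{−1} N₁⋯N_k). -/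
open Real Finset

/-- A finite set of naturals of diameter at most `D` has at most `D + 1` elements. -/
lemma Finset.card_le_add_one_of_sub_le {s : Finset ℕ} {D : ℝ} (hD : 0 ≤ D)
    (h : ∀ a ∈ s, ∀ b ∈ s, (b : ℝ) - a ≤ D) : (#s : ℝ) ≤ D + 1 := by
  rcases s.eq_empty_or_nonempty with rfl | hs
  · simp only [Finset.card_empty, Nat.cast_zero]
    positivity
  have hsub : s ⊆ Finset.Icc (s.min' hs) (s.max' hs) := fun x hx =>
    Finset.mem_Icc.2 ⟨s.min'_le x hx, s.le_max' x hx⟩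
  have hcard := Finset.card_le_card hsub
  rw [Nat.card_Icc] at hcard
  have hle : s.min' hs ≤ s.max' hs := s.min'_le _ (s.max'_mem hs)
  have hdiam := h _ (s.min'_mem hs) _ (s.max'_mem hs)
  have hcard' : #s + s.min' hs ≤ s.max' hs + 1 := by omega
  have : (#s : ℝ) + (s.min' hs : ℕ) ≤ (s.max' hs : ℕ) + 1 := by exact_mod_cast hcard'
  linarith

lemma rpow_one_div_four_pow_four {x : ℝ} (hx : 0 ≤ x) : (x ^ ((1 : ℝ) / 4)) ^ 4 = x := by
  rw [← Real.rpow_natCast, ← Real.rpow_mul hx]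
  norm_num

lemma pow_four_sub_le {x y h Δ : ℝ} (hx : 0 ≤ x) (hy : 0 ≤ y) (hh : 0 ≤ h) (hΔ : 0 ≤ Δ)
    (hxh : x ^ 4 ≤ 2 * h ^ 4) (hxy : x - y ≤ 2 * Δ) :
    x ^ 4 - y ^ 4 ≤ 64 * Δ * h ^ 3 := by
  rcases le_total x y with hle | hle
  · have : x ^ 4 ≤ y ^ 4 := by gcongr
    have : 0 ≤ 64 * Δ * h ^ 3 := by positivity
    linarith
  · have hx2 : x ≤ 2 * h := by
      refine le_of_pow_le_pow_left₀ (n := 4) (by norm_num) (by positivity) ?_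
      nlinarith [pow_nonneg hh 4]
    calc x ^ 4 - y ^ 4 = (x - y) * ((x + y) * (x ^ 2 + y ^ 2)) := by ring
      _ ≤ (2 * Δ) * ((2 * h + 2 * h) * ((2 * h) ^ 2 + (2 * h) ^ 2)) := by
          have := hle.trans hx2
          gcongr
      _ = 64 * Δ * h ^ 3 := by ring

/-- If two tuples agree off `J` then the difference of their signed sums is the difference of
the `J`-th terms. -/
lemma abs_alphaRS_sub {k : ℕ} {n m : Fin k → ℕ} (i : Fin k → Bool) {J : Fin k}
    (h : ∀ j, j ≠ J → n j = m j) :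
    |alphaRS n i - alphaRS m i| =
      |(n J : ℝ) ^ ((1 : ℝ) / 4) - (m J : ℝ) ^ ((1 : ℝ) / 4)| := by
  unfold alphaRS
  rw [← Finset.sum_sub_distrib, Finset.sum_eq_single J]
  · rw [← mul_sub, abs_mul]
    split_ifs <;> simp
  · intro j _ hj
    rw [h j hj, sub_self]
  · simp

/-- The bound obtained by counting the largest coordinate with all the others fixed. -/
lemma card_abs_alphaRS_lt_le {k : ℕ} (i : Fin k → Bool) {N : Fin k → ℝ} (hN : ∀ j, 1 < N j)
    {Δ h : ℝ} (hΔ : 0 < Δ) (hh : 0 < h) {J : Fin k} (hJ : N J = h ^ 4) :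
    (Nat.card {n : Fin k → ℕ // (∀ j, N j < (n j : ℝ) ∧ (n j : ℝ) ≤ 2 * N j) ∧
        |alphaRS n i| < Δ} : ℝ) ≤
      (64 * Δ * h ^ 3 + 1) * (2 ^ k * ∏ j ∈ univ.erase J, N j) := by
  classical
  set R : Fin k → Finset ℕ := fun j => Finset.Ioc ⌊N j⌋₊ ⌊2 * N j⌋₊ with hR
  have hN0 : ∀ j, 0 ≤ N j := fun j => (zero_lt_one.trans (hN j)).le
  have hmem : ∀ j x, x ∈ R j ↔ N j < (x : ℝ) ∧ (x : ℝ) ≤ 2 * N j := fun j x => by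
    rw [hR, Finset.mem_Ioc, Nat.floor_lt (hN0 j), Nat.le_floor_iff (by linarith [hN0 j])]
  have hRcard : ∀ j, (#(R j) : ℝ) ≤ 2 * N j := fun j => by
    rw [hR, Nat.card_Ioc]
    exact (Nat.cast_le.2 (Nat.sub_le _ _)).trans (Nat.floor_le (by linarith [hN0 j]))
  set S := (Fintype.piFinset R).filter fun n => |alphaRS n i| < Δ with hS
  have hcardS : Nat.card {n : Fin k → ℕ // (∀ j, N j < (n j : ℝ) ∧ (n j : ℝ) ≤ 2 * N j) ∧
      |alphaRS n i| < Δ} = #S :=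
    Nat.subtype_card S fun n => by simp only [hS, Finset.mem_filter, Fintype.mem_piFinset, hmem]
  rw [hcardS]
  set T : Finset (Fin k → ℕ) := Fintype.piFinset fun j => if j = J then {0} else R j with hT
  have hmaps : ∀ n ∈ S, Function.update n J 0 ∈ T := fun n hn => by
    rw [hS, Finset.mem_filter, Fintype.mem_piFinset] at hn
    rw [hT, Fintype.mem_piFinset]
    intro j
    by_cases hj : j = J
    · subst hj
      simp
    · simpa [hj] using hn.1 j
  have hD : 0 ≤ 64 * Δ * h ^ 3 := by positivity
  have hfiber : ∀ t ∈ T, #{n ∈ S | Function.update n J 0 = t} ≤ ⌊64 * Δ * h ^ 3 + 1⌋₊ := by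
    intro t _
    have hagree : ∀ n m : Fin k → ℕ, Function.update n J 0 = t → Function.update m J 0 = t →
        ∀ j, j ≠ J → n j = m j := fun n m hn hm j hj => by
      simpa [hj] using congrFun (hn.trans hm.symm) j
    have hinj : Set.InjOn (fun n : Fin k → ℕ => n J)
        ({n ∈ S | Function.update n J 0 = t} : Finset (Fin k → ℕ)) := by
      intro n hn m hm hnm
      rw [Finset.mem_coe, Finset.mem_filter] at hn hm
      funext j
      by_cases hj : j = J
      · subst hj
        exact hnm
      · exact hagree n m hn.2 hm.2 j hj
    rw [Nat.le_floor_iff (by positivity), ← Finset.card_image_of_injOn hinj]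
    refine Finset.card_le_add_one_of_sub_le hD fun a ha b hb => ?_
    obtain ⟨n, hn, rfl⟩ := Finset.mem_image.1 ha
    obtain ⟨m, hm, rfl⟩ := Finset.mem_image.1 hb
    rw [Finset.mem_filter, hS, Finset.mem_filter, Fintype.mem_piFinset] at hn hm
    have hsub := abs_alphaRS_sub i (hagree m n hm.2 hn.2)
    have hclose : |alphaRS m i - alphaRS n i| ≤ 2 * Δ :=
      (abs_sub _ _).trans (by linarith [hn.1.2, hm.1.2])
    rw [hsub] at hclose
    have hmJ := ((hmem J _).1 (hm.1.1 J)).2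
    have := pow_four_sub_le (x := (m J : ℝ) ^ ((1 : ℝ) / 4)) (y := (n J : ℝ) ^ ((1 : ℝ) / 4))
      (by positivity) (by positivity) hh.le hΔ.le
      (by rwa [rpow_one_div_four_pow_four (Nat.cast_nonneg _), ← hJ])
      ((le_abs_self _).trans hclose)
    rwa [rpow_one_div_four_pow_four (Nat.cast_nonneg _),
      rpow_one_div_four_pow_four (Nat.cast_nonneg _)] at this
  have hTcard : (#T : ℝ) ≤ 2 ^ k * ∏ j ∈ univ.erase J, N j := by
    rw [hT, Fintype.card_piFinset, ← Finset.mul_prod_erase _ _ (Finset.mem_univ J)]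
    simp only [if_true, Finset.card_singleton, one_mul]
    push_cast
    calc ∏ j ∈ univ.erase J, (#(if j = J then {0} else R j) : ℝ)
        ≤ ∏ j ∈ univ.erase J, 2 * N j := by
          refine Finset.prod_le_prod (fun _ _ => Nat.cast_nonneg _) fun j hj => ?_
          rw [if_neg (Finset.ne_of_mem_erase hj)]
          exact hRcard j
      _ = 2 ^ (k - 1) * ∏ j ∈ univ.erase J, N j := by
          simp [Finset.prod_mul_distrib, Finset.card_erase_of_mem]
      _ ≤ 2 ^ k * ∏ j ∈ univ.erase J, N j := by
          have := Finset.prod_nonneg fun j (_ : j ∈ univ.erase J) => hN0 j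
          gcongr
          · norm_num
          · omega
  calc (#S : ℝ) ≤ (⌊64 * Δ * h ^ 3 + 1⌋₊ : ℝ) * #T := by
        exact_mod_cast Finset.card_le_mul_card_image_of_maps_to hmaps _ hfiber
    _ ≤ (64 * Δ * h ^ 3 + 1) * (2 ^ k * ∏ j ∈ univ.erase J, N j) := by
        gcongr
        exact Nat.floor_le (by positivity)

theorem stmt_2 (k : ℕ) (hk : 3 ≤ k) :
    ∃ C : ℝ, 0 < C ∧ ∀ (i : Fin k → Bool), i ⟨0, by omega⟩ = false → i ≠ (fun _ => false) →
      ∀ N : Fin k → ℝ, (∀ j, 1 < N j) → ∀ Δ : ℝ, 0 < Δ → Δ ≤ (⨆ j, N j) ^ ((1 : ℝ) / 4) →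
      (Nat.card {n : Fin k → ℕ // (∀ j, N j < (n j : ℝ) ∧ (n j : ℝ) ≤ 2 * N j) ∧
          |alphaRS n i| < Δ} : ℝ) ≤
        C * (Δ * (⨆ j, N j) ^ (-(1 : ℝ) / 4) * ∏ j, N j + (⨆ j, N j)⁻¹ * ∏ j, N j) := by
  refine ⟨64 * 2 ^ k, by positivity, fun i _ _ N hN Δ hΔ _ => ?_⟩
  have : Nonempty (Fin k) := ⟨⟨0, by omega⟩⟩
  obtain ⟨J, hJ⟩ := exists_eq_ciSup_of_finite (f := N)
  rw [← hJ]
  have hNJ : 0 < N J := zero_lt_one.trans (hN J)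
  set h := N J ^ ((1 : ℝ) / 4) with hh_def
  have hh : 0 < h := Real.rpow_pos_of_pos hNJ _
  have hh4 : N J = h ^ 4 := (rpow_one_div_four_pow_four hNJ.le).symm
  have hinv : N J ^ (-(1 : ℝ) / 4) = h⁻¹ := by
    rw [hh_def, ← Real.rpow_neg hNJ.le, neg_div]
  refine (card_abs_alphaRS_lt_le i hN hΔ hh hh4).trans ?_
  rw [hinv, ← Finset.mul_prod_erase _ _ (Finset.mem_univ J), hh4]
  have hP : 0 ≤ ∏ j ∈ univ.erase J, N j :=
    Finset.prod_nonneg fun j _ => (zero_lt_one.trans (hN j)).le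
  set P := ∏ j ∈ univ.erase J, N j
  calc (64 * Δ * h ^ 3 + 1) * (2 ^ k * P) ≤ (64 * Δ * h ^ 3 + 64) * (2 ^ k * P) := by
        gcongr
        norm_num
    _ = 64 * 2 ^ k * (Δ * h⁻¹ * (h ^ 4 * P) + (h ^ 4)⁻¹ * (h ^ 4 * P)) := by
        field_simp
end

section
/- Let c > 0 be a real number which is not an integer and let ε > 0. Then there is a constant C = C(c,ε) > 0 such that for every real M ≥ 2 and every real δ > 0, the number A(M,δ;c) of quadruples (m₁,m₂,m₃,m₄) of integers with M < m₁,m₂,m₃,m₄ ≤ 2M satisfying |m₁^c + m₂^c − m₃^c − m₄^c| ≤ δ M^c is at most C · M^ε (M² + δ M⁴). -/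
open Real

/-- Parseval's identity for exponential sums over a finite subset of `(ℤ/Pℤ)^ι`. -/
theorem sum_norm_sq_sum_stdAddChar {ι : Type*} [Fintype ι] [DecidableEq ι] (P : ℕ) [NeZero P]
    (X : Finset (ι → ZMod P)) :
    ∑ g : ι → ZMod P, ‖∑ x ∈ X, ZMod.stdAddChar (∑ i, g i * x i)‖ ^ 2 =
      (P : ℝ) ^ Fintype.card ι * X.card := by
  have key : ∀ z : ι → ZMod P, ∑ g : ι → ZMod P, ZMod.stdAddChar (∑ i, g i * z i) =
      if z = 0 then ((P : ℂ) ^ Fintype.card ι) else 0 := by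
    intro z
    split_ifs with hz
    · simp [hz, Fintype.card_pi, ZMod.card]
    · obtain ⟨i, hi⟩ : ∃ i, z i ≠ 0 := by
        by_contra! h
        exact hz (funext h)
      have h0 : ∑ t : ZMod P, ZMod.stdAddChar (t * z i) = 0 := by
        have := AddChar.sum_mulShift (z i) (ZMod.isPrimitive_stdAddChar P)
        simpa [hi] using this
      have hprod : ∀ g : ι → ZMod P, ZMod.stdAddChar (∑ i, g i * z i) =
          ∏ i, ZMod.stdAddChar (N := P) (g i * z i) := fun g =>
        map_prod (ZMod.stdAddChar (N := P)).toMonoidHom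
          (fun i => Multiplicative.ofAdd (g i * z i)) Finset.univ
      simp_rw [hprod]
      rw [← Fintype.prod_sum (fun i (t : ZMod P) => ZMod.stdAddChar (N := P) (t * z i))]
      exact Finset.prod_eq_zero (Finset.mem_univ i) h0
  have hsq : ∀ g : ι → ZMod P,
      ((‖∑ x ∈ X, ZMod.stdAddChar (∑ i, g i * x i)‖ ^ 2 : ℝ) : ℂ) =
      ∑ x ∈ X, ∑ y ∈ X, ZMod.stdAddChar (∑ i, g i * (x - y) i) := by
    intro g
    push_cast
    rw [← Complex.mul_conj', map_sum, Finset.sum_mul_sum]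
    refine Finset.sum_congr rfl fun x _ => Finset.sum_congr rfl fun y _ => ?_
    rw [← AddChar.map_neg_eq_conj, ← AddChar.map_add_eq_mul]
    congr 1
    rw [← sub_eq_add_neg, ← Finset.sum_sub_distrib]
    simp only [Pi.sub_apply, mul_sub]
  have : ((∑ g : ι → ZMod P, ‖∑ x ∈ X, ZMod.stdAddChar (∑ i, g i * x i)‖ ^ 2 : ℝ) : ℂ) =
      (P : ℂ) ^ Fintype.card ι * X.card := by
    rw [Complex.ofReal_sum]
    simp_rw [hsq]
    rw [Finset.sum_comm]
    have h2 : ∀ x ∈ X, ∑ g : ι → ZMod P, ∑ y ∈ X, ZMod.stdAddChar (∑ i, g i * (x - y) i) =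
        (P : ℂ) ^ Fintype.card ι := by
      intro x hx
      rw [Finset.sum_comm]
      simp_rw [key, sub_eq_zero]
      simp [hx]
    rw [Finset.sum_congr rfl h2]
    simp [mul_comm]
  exact_mod_cast this

/-- If the frequencies `g k / P` nearly annihilate `X` and at most `D` of them coincide modulo
`1`, then `X` is small. -/
theorem card_mul_card_le_of_phase_small {ι κ : Type*} [Fintype ι] [DecidableEq ι]
    (P : ℕ) [NeZero P] (X : Finset (ι → ℤ)) (I : Finset κ) (g : κ → ι → ℤ) (D : ℕ)
    (hX : ∀ x ∈ X, ∀ y ∈ X, (∀ i, (P : ℤ) ∣ x i - y i) → x = y)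
    (hphase : ∀ k ∈ I, ∀ x ∈ X, |∑ i, (g k i : ℝ) * x i| ≤ P / 16)
    (hfib : ∀ k ∈ I, (I.filter fun k' => ∀ i, (P : ℤ) ∣ g k' i - g k i).card ≤ D) :
    (I.card : ℝ) * X.card ≤ 4 * D * (P : ℝ) ^ Fintype.card ι := by
  have hP : (0 : ℝ) < P := by exact_mod_cast Nat.pos_of_ne_zero (NeZero.ne P)
  have hcast : ∀ m n : ℤ, (P : ℤ) ∣ m - n → (m : ZMod P) = n := fun m n h => by
    have := (ZMod.intCast_zmod_eq_zero_iff_dvd (m - n) P).2 h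
    push_cast at this
    exact sub_eq_zero.1 this
  have hcast' : ∀ m n : ℤ, (m : ZMod P) = n → (P : ℤ) ∣ m - n := fun m n h => by
    rw [← ZMod.intCast_zmod_eq_zero_iff_dvd]
    push_cast
    exact sub_eq_zero.2 h
  let q : (ι → ℤ) → (ι → ZMod P) := fun x i => (x i : ZMod P)
  have hinj : Set.InjOn q X := fun x hx y hy h =>
    hX x hx y hy fun i => hcast' _ _ (congrFun h i)
  let E : (ι → ZMod P) → ℝ := fun v => ‖∑ x ∈ X.image q, ZMod.stdAddChar (∑ i, v i * x i)‖ ^ 2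
  have hlow : ∀ k ∈ I, (X.card : ℝ) ^ 2 / 4 ≤ E (q (g k)) := by
    intro k hk
    have hE : ∑ x ∈ X.image q, ZMod.stdAddChar (∑ i, q (g k) i * x i) =
        ∑ x ∈ X, Complex.exp (Complex.I * ((2 * π * (∑ i, (g k i : ℝ) * x i) / P : ℝ) : ℂ)) := by
      rw [Finset.sum_image hinj]
      refine Finset.sum_congr rfl fun x _ => ?_
      have : (∑ i, q (g k) i * q x i : ZMod P) = ((∑ i, g k i * x i : ℤ) : ZMod P) := by
        simp [q]
      rw [this, ZMod.stdAddChar_coe]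
      congr 1
      push_cast
      ring
    have hdiff : ‖∑ x ∈ X, Complex.exp
          (Complex.I * ((2 * π * (∑ i, (g k i : ℝ) * x i) / P : ℝ) : ℂ)) - X.card‖ ≤
        X.card * (1 / 2) := by
      have : ∑ x ∈ X, Complex.exp
          (Complex.I * ((2 * π * (∑ i, (g k i : ℝ) * x i) / P : ℝ) : ℂ)) - X.card =
          ∑ x ∈ X, (Complex.exp
          (Complex.I * ((2 * π * (∑ i, (g k i : ℝ) * x i) / P : ℝ) : ℂ)) - 1) := by simp
      rw [this, ← nsmul_eq_mul, ← Finset.sum_const]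
      refine norm_sum_le_of_le _ fun x hx => ?_
      refine Real.norm_exp_I_mul_ofReal_sub_one_le.trans ?_
      rw [Real.norm_eq_abs, abs_div, abs_mul, abs_of_pos hP, abs_of_pos Real.two_pi_pos,
        div_le_iff₀ hP]
      have := hphase k hk x hx
      nlinarith [Real.pi_lt_four, Real.pi_pos, abs_nonneg (∑ i, (g k i : ℝ) * x i)]
    have hge : (X.card : ℝ) / 2 ≤ ‖∑ x ∈ X, Complex.exp
          (Complex.I * ((2 * π * (∑ i, (g k i : ℝ) * x i) / P : ℝ) : ℂ))‖ := by
      have h1 := norm_sub_norm_le (X.card : ℂ) (∑ x ∈ X, Complex.exp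
          (Complex.I * ((2 * π * (∑ i, (g k i : ℝ) * x i) / P : ℝ) : ℂ)))
      rw [norm_sub_rev, Complex.norm_natCast] at h1
      linarith
    have : E (q (g k)) = ‖∑ x ∈ X, Complex.exp
          (Complex.I * ((2 * π * (∑ i, (g k i : ℝ) * x i) / P : ℝ) : ℂ))‖ ^ 2 := by
      simp only [E]
      rw [hE]
    rw [this]
    have hc : (0 : ℝ) ≤ X.card := Nat.cast_nonneg _
    nlinarith
  have hup : ∑ k ∈ I, E (q (g k)) ≤ D * ∑ v, E v := by
    classical
    rw [← Finset.sum_fiberwise I (fun k => q (g k)), Finset.mul_sum]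
    refine Finset.sum_le_sum fun v _ => ?_
    rw [Finset.sum_congr rfl (g := fun _ => E v)
      (fun k hk => by rw [(Finset.mem_filter.1 hk).2]), Finset.sum_const, nsmul_eq_mul]
    refine mul_le_mul_of_nonneg_right ?_ (by positivity)
    rcases (I.filter fun k => q (g k) = v).eq_empty_or_nonempty with h | ⟨k, hk⟩
    · simp [h]
    · rw [Finset.mem_filter] at hk
      have := hfib k hk.1
      refine (Nat.cast_le.2 ((Finset.card_le_card ?_).trans this))
      intro k' hk'
      rw [Finset.mem_filter] at hk' ⊢
      exact ⟨hk'.1, fun i => hcast' _ _ (congrFun (hk'.2.trans hk.2.symm) i)⟩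
  rw [sum_norm_sq_sum_stdAddChar, Finset.card_image_of_injOn hinj] at hup
  have h3 : (I.card : ℝ) * ((X.card : ℝ) ^ 2 / 4) ≤
      D * ((P : ℝ) ^ Fintype.card ι * X.card) := by
    refine le_trans ?_ hup
    rw [← nsmul_eq_mul]
    exact Finset.card_nsmul_le_sum _ _ _ hlow
  rcases X.card.eq_zero_or_pos with h | h
  · rw [h]; simp; positivity
  · have : (0 : ℝ) < X.card := by exact_mod_cast h
    have h4 : (X.card : ℝ) * ((I.card : ℝ) * X.card) ≤
        X.card * (4 * D * (P : ℝ) ^ Fintype.card ι) := by nlinarith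
    exact le_of_mul_le_mul_left h4 this

/-- The integer points of the box polar to the cap of the cone around a base point. -/
def IsDualPoint (b₀ b₁ b₃ ρ₀ ρ₁ s u w : ℝ) (a : Fin 4 → ℤ) : Prop :=
  |(a 2 : ℝ)| ≤ s ∧ |a 0 - b₀ * a 2| ≤ u ∧ |a 1 - b₁ * a 2| ≤ u ∧
    |a 3 - b₃ * a 2 - ρ₀ * (a 0 - b₀ * a 2) - ρ₁ * (a 1 - b₁ * a 2)| ≤ w

/-- Triangular parametrisation of the grid points of a polar box. -/
noncomputable def boxPoint (b₀ b₁ b₃ ρ₀ ρ₁ : ℝ) (k : ℕ × ℕ × ℕ × ℕ) : Fin 4 → ℤ :=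
  let A₀ : ℤ := ⌊b₀ * k.1⌋ + k.2.1
  let A₁ : ℤ := ⌊b₁ * k.1⌋ + k.2.2.1
  ![A₀, A₁, k.1, ⌊b₃ * k.1 + ρ₀ * (A₀ - b₀ * k.1) + ρ₁ * (A₁ - b₁ * k.1)⌋ + k.2.2.2]

theorem boxPoint_injective (b₀ b₁ b₃ ρ₀ ρ₁ : ℝ) :
    Function.Injective (boxPoint b₀ b₁ b₃ ρ₀ ρ₁) := by
  rintro ⟨i, j, k, l⟩ ⟨i', j', k', l'⟩ h
  have h0 := congrFun h 0
  have h1 := congrFun h 1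
  have h2 := congrFun h 2
  have h3 := congrFun h 3
  simp only [boxPoint, Matrix.cons_val] at h0 h1 h2 h3
  have e2 : i = i' := by exact_mod_cast h2
  subst e2
  have e0 : j = j' := by simpa using h0
  have e1 : k = k' := by simpa using h1
  subst e0 e1
  have e3 : l = l' := by simpa using h3
  rw [e3]

theorem boxPoint_bounds (b₀ b₁ b₃ ρ₀ ρ₁ : ℝ) (k : ℕ × ℕ × ℕ × ℕ) :
    let A := boxPoint b₀ b₁ b₃ ρ₀ ρ₁ k
    ((A 2 : ℝ) = k.1) ∧
    ((k.2.1 : ℝ) - 1 < A 0 - b₀ * A 2 ∧ A 0 - b₀ * A 2 ≤ k.2.1) ∧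
    ((k.2.2.1 : ℝ) - 1 < A 1 - b₁ * A 2 ∧ A 1 - b₁ * A 2 ≤ k.2.2.1) ∧
    ((k.2.2.2 : ℝ) - 1 < A 3 - b₃ * A 2 - ρ₀ * (A 0 - b₀ * A 2) - ρ₁ * (A 1 - b₁ * A 2) ∧
      A 3 - b₃ * A 2 - ρ₀ * (A 0 - b₀ * A 2) - ρ₁ * (A 1 - b₁ * A 2) ≤ k.2.2.2) := by
  simp only [boxPoint, Matrix.cons_val]
  push_cast
  have f0 := Int.floor_le (b₀ * k.1)
  have f0' := Int.lt_floor_add_one (b₀ * k.1)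
  have f1 := Int.floor_le (b₁ * k.1)
  have f1' := Int.lt_floor_add_one (b₁ * k.1)
  have f3 := Int.floor_le (b₃ * k.1 + ρ₀ * (⌊b₀ * k.1⌋ + k.2.1 - b₀ * k.1) +
    ρ₁ * (⌊b₁ * k.1⌋ + k.2.2.1 - b₁ * k.1))
  have f3' := Int.lt_floor_add_one (b₃ * k.1 + ρ₀ * (⌊b₀ * k.1⌋ + k.2.1 - b₀ * k.1) +
    ρ₁ * (⌊b₁ * k.1⌋ + k.2.2.1 - b₁ * k.1))
  refine ⟨rfl, ⟨?_, ?_⟩, ⟨?_, ?_⟩, ⟨?_, ?_⟩⟩ <;> linarith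

/-- Transference: the number of lattice points of a box in `ℝ⁴` is at most a constant times the
volume of the box times the number of lattice points of the polar box. -/
theorem card_mul_volume_le_of_dual (X K : Finset (Fin 4 → ℤ)) {b₀ b₁ b₃ ρ₀ ρ₁ s u w : ℝ}
    (hs : 0 < s) (hu : 0 < u) (hw : 0 < w)
    (h₂ : ∀ x ∈ X, s * |b₀ * x 0 + b₁ * x 1 - x 2 - b₃ * x 3| ≤ 1 / 64)
    (h₀ : ∀ x ∈ X, u * |x 0 - ρ₀ * x 3| ≤ 1 / 64)
    (h₁ : ∀ x ∈ X, u * |x 1 - ρ₁ * x 3| ≤ 1 / 64)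
    (h₃ : ∀ x ∈ X, w * |(x 3 : ℝ)| ≤ 1 / 64)
    (hK : ∀ a, IsDualPoint b₀ b₁ b₃ ρ₀ ρ₁ s u w a → a ∈ K) :
    (X.card : ℝ) * (s * u ^ 2 * w) ≤ 64 * K.card := by
  obtain ⟨B, hB⟩ : ∃ B : ℕ, ∀ x ∈ X, ∀ i, (x i).natAbs ≤ B := by
    refine ⟨∑ x ∈ X, ∑ i, (x i).natAbs, fun x hx i => ?_⟩
    exact (Finset.single_le_sum (f := fun i => (x i).natAbs) (fun _ _ => Nat.zero_le _)
      (Finset.mem_univ i)).trans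
      (Finset.single_le_sum (f := fun x : Fin 4 → ℤ => ∑ i, (x i).natAbs)
        (fun _ _ => Nat.zero_le _) hx)
  obtain ⟨P, hPB, hPs, hPu, hPw⟩ : ∃ P : ℕ, 2 * B + 1 ≤ P ∧ 1 ≤ P * s ∧ 1 ≤ P * u ∧ 1 ≤ P * w := by
    refine ⟨2 * B + 1 + ⌈1 / s⌉₊ + ⌈1 / u⌉₊ + ⌈1 / w⌉₊, by omega, ?_, ?_, ?_⟩
    · have := Nat.le_ceil (1 / s)
      rw [div_le_iff₀ hs] at this
      push_cast
      nlinarith [mul_nonneg (Nat.cast_nonneg (α := ℝ) B) hs.le,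
        mul_nonneg (Nat.cast_nonneg (α := ℝ) ⌈1 / u⌉₊) hs.le,
        mul_nonneg (Nat.cast_nonneg (α := ℝ) ⌈1 / w⌉₊) hs.le]
    · have := Nat.le_ceil (1 / u)
      rw [div_le_iff₀ hu] at this
      push_cast
      nlinarith [mul_nonneg (Nat.cast_nonneg (α := ℝ) B) hu.le,
        mul_nonneg (Nat.cast_nonneg (α := ℝ) ⌈1 / s⌉₊) hu.le,
        mul_nonneg (Nat.cast_nonneg (α := ℝ) ⌈1 / w⌉₊) hu.le]
    · have := Nat.le_ceil (1 / w)
      rw [div_le_iff₀ hw] at this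
      push_cast
      nlinarith [mul_nonneg (Nat.cast_nonneg (α := ℝ) B) hw.le,
        mul_nonneg (Nat.cast_nonneg (α := ℝ) ⌈1 / s⌉₊) hw.le,
        mul_nonneg (Nat.cast_nonneg (α := ℝ) ⌈1 / u⌉₊) hw.le]
  have : NeZero P := ⟨by omega⟩
  have hP : (0 : ℝ) < P := by exact_mod_cast (by omega : 0 < P)
  let I : Finset (ℕ × ℕ × ℕ × ℕ) := Finset.range ⌊P * s⌋₊ ×ˢ Finset.range ⌊P * u⌋₊ ×ˢ
    Finset.range ⌊P * u⌋₊ ×ˢ Finset.range ⌊P * w⌋₊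
  have hhalf : ∀ t : ℝ, 1 ≤ t → t / 2 ≤ ⌊t⌋₊ := fun t ht => by
    have h1 := Nat.lt_floor_add_one t
    have h2 : (1 : ℝ) ≤ ⌊t⌋₊ := by exact_mod_cast Nat.one_le_floor_iff _ |>.2 ht
    linarith
  have hlt : ∀ (t : ℝ) (n : ℕ), 0 ≤ t → n < ⌊t⌋₊ → (n : ℝ) + 1 ≤ t := fun t n ht h => by
    have h1 := Nat.floor_le ht
    have h2 : (n : ℝ) + 1 ≤ ⌊t⌋₊ := by exact_mod_cast h
    linarith
  have hI : (P : ℝ) ^ 4 * (s * u ^ 2 * w) / 16 ≤ I.card := by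
    simp only [I, Finset.card_product, Finset.card_range]
    push_cast
    calc (P : ℝ) ^ 4 * (s * u ^ 2 * w) / 16
        = (P * s / 2) * ((P * u / 2) * ((P * u / 2) * (P * w / 2))) := by ring
      _ ≤ _ := by
        gcongr
        exacts [hhalf _ hPs, hhalf _ hPu, hhalf _ hPu, hhalf _ hPw]
  let A := boxPoint b₀ b₁ b₃ ρ₀ ρ₁
  have hA : ∀ k ∈ I, (0 ≤ (A k 2 : ℝ) ∧ (A k 2 : ℝ) + 1 ≤ P * s) ∧
      (-1 < A k 0 - b₀ * A k 2 ∧ A k 0 - b₀ * A k 2 + 1 ≤ P * u) ∧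
      (-1 < A k 1 - b₁ * A k 2 ∧ A k 1 - b₁ * A k 2 + 1 ≤ P * u) ∧
      (-1 < A k 3 - b₃ * A k 2 - ρ₀ * (A k 0 - b₀ * A k 2) - ρ₁ * (A k 1 - b₁ * A k 2) ∧
      A k 3 - b₃ * A k 2 - ρ₀ * (A k 0 - b₀ * A k 2) - ρ₁ * (A k 1 - b₁ * A k 2) + 1
        ≤ P * w) := by
    intro k hk
    simp only [I, Finset.mem_product, Finset.mem_range] at hk
    obtain ⟨k0, k1, k2, k3⟩ := hk
    obtain ⟨e0, e1, e2, e3⟩ := boxPoint_bounds b₀ b₁ b₃ ρ₀ ρ₁ k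
    have l0 := hlt _ _ (by positivity) k0
    have l1 := hlt _ _ (by positivity) k1
    have l2 := hlt _ _ (by positivity) k2
    have l3 := hlt _ _ (by positivity) k3
    have c0 : (0 : ℝ) ≤ k.1 := Nat.cast_nonneg _
    have c1 : (0 : ℝ) ≤ k.2.1 := Nat.cast_nonneg _
    have c2 : (0 : ℝ) ≤ k.2.2.1 := Nat.cast_nonneg _
    have c3 : (0 : ℝ) ≤ k.2.2.2 := Nat.cast_nonneg _
    refine ⟨⟨?_, ?_⟩, ⟨?_, ?_⟩, ⟨?_, ?_⟩, ⟨?_, ?_⟩⟩ <;> simp only [A] <;> linarith [e1.1, e1.2,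
      e2.1, e2.2, e3.1, e3.2]
  have main := card_mul_card_le_of_phase_small P X I
    (fun k => ![A k 0, A k 1, -A k 2, -A k 3]) K.card ?_ ?_ ?_
  · have hX0 : (0 : ℝ) ≤ X.card := Nat.cast_nonneg _
    have := mul_le_mul_of_nonneg_right hI hX0
    simp only [Fintype.card_fin] at main
    have h5 : (P : ℝ) ^ 4 * (X.card * (s * u ^ 2 * w)) ≤ P ^ 4 * (64 * K.card) := by
      nlinarith
    exact le_of_mul_le_mul_left h5 (by positivity)
  · intro x hx y hy h
    funext i
    obtain ⟨t, ht⟩ := h i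
    have h1 := hB x hx i
    have h2 := hB y hy i
    have : t = 0 := by
      by_contra h0
      have h3 : (P : ℤ) ≤ |x i - y i| := by
        rw [ht, abs_mul, Nat.abs_cast]
        nlinarith [Int.one_le_abs h0]
      rcases abs_cases (x i - y i) with h | h <;> omega
    rw [this] at ht
    omega
  · intro k hk x hx
    obtain ⟨⟨a0, a1⟩, ⟨c0, c1⟩, ⟨d0, d1⟩, ⟨e0, e1⟩⟩ := hA k hk
    set σ : ℝ := ((A k 2 : ℤ) : ℝ) with hσ
    set U₀ := (A k 0 : ℝ) - b₀ * σ with hU₀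
    set U₁ := (A k 1 : ℝ) - b₁ * σ with hU₁
    set W := (A k 3 : ℝ) - b₃ * σ - ρ₀ * U₀ - ρ₁ * U₁ with hW
    have hid : ∑ i, ((![A k 0, A k 1, -A k 2, -A k 3] i : ℤ) : ℝ) * x i =
        σ * (b₀ * x 0 + b₁ * x 1 - x 2 - b₃ * x 3) + U₀ * (x 0 - ρ₀ * x 3) +
          U₁ * (x 1 - ρ₁ * x 3) + -W * x 3 := by
      simp only [Fin.sum_univ_four, Matrix.cons_val, hU₀, hU₁, hW, hσ]
      push_cast
      ring
    have bnd : ∀ (p q t : ℝ), |p| ≤ P * t → t * |q| ≤ 1 / 64 → |p * q| ≤ P / 64 := by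
      intro p q t h h'
      rw [abs_mul]
      nlinarith [abs_nonneg q, abs_nonneg p]
    have b2 := bnd σ _ s (abs_le.2 ⟨by linarith, by linarith⟩) (h₂ x hx)
    have b0 := bnd U₀ _ u (abs_le.2 ⟨by linarith, by linarith⟩) (h₀ x hx)
    have b1 := bnd U₁ _ u (abs_le.2 ⟨by linarith, by linarith⟩) (h₁ x hx)
    have b3 := bnd (-W) _ w (abs_le.2 ⟨by linarith, by linarith⟩) (h₃ x hx)
    rw [hid]
    refine (abs_add_le _ _).trans ?_
    have t1 := abs_add_le (σ * (b₀ * x 0 + b₁ * x 1 - x 2 - b₃ * x 3) + U₀ * (x 0 - ρ₀ * x 3))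
      (U₁ * (x 1 - ρ₁ * x 3))
    have t2 := abs_add_le (σ * (b₀ * x 0 + b₁ * x 1 - x 2 - b₃ * x 3)) (U₀ * (x 0 - ρ₀ * x 3))
    linarith
  · intro k hk
    have hdiv : ∀ k', (∀ i, (P : ℤ) ∣
        ![A k' 0, A k' 1, -A k' 2, -A k' 3] i - ![A k 0, A k 1, -A k 2, -A k 3] i) →
        ∀ i, (P : ℤ) ∣ A k' i - A k i := by
      intro k' this i
      have hneg : ∀ x y : ℤ, (P : ℤ) ∣ -x - -y → (P : ℤ) ∣ x - y := fun x y h => by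
        have e : x - y = -(-x - -y) := by ring
        exact e ▸ h.neg_right
      fin_cases i
      exacts [this 0, this 1, hneg _ _ (this 2), hneg _ _ (this 3)]
    refine Finset.card_le_card_of_injOn (fun k' i => (A k' i - A k i) / P) ?_ ?_
    · intro k' hk'
      simp only [Finset.coe_filter, Set.mem_ofPred_eq] at hk'
      have hd := hdiv k' hk'.2
      apply hK
      have hk'I := hk'.1
      have hq : ∀ i, (((A k' i - A k i) / (P : ℤ) : ℤ) : ℝ) = (A k' i - A k i) / P := by
        intro i
        rw [Int.cast_div (hd i) (by exact_mod_cast hP.ne')]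
        push_cast
        rfl
      obtain ⟨⟨a0, a1⟩, ⟨c0, c1⟩, ⟨d0, d1⟩, ⟨e0, e1⟩⟩ := hA k hk
      obtain ⟨⟨a0', a1'⟩, ⟨c0', c1'⟩, ⟨d0', d1'⟩, ⟨e0', e1'⟩⟩ := hA k' hk'I
      have bnd : ∀ p q r t : ℝ, r = (p - q) / P → |p - q| ≤ P * t → |r| ≤ t := by
        intro p q r t h h'
        rw [h, abs_div, abs_of_pos hP, div_le_iff₀ hP]
        linarith
      refine ⟨bnd _ _ _ _ (hq 2) (abs_le.2 ⟨by linarith, by linarith⟩),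
        bnd (A k' 0 - b₀ * A k' 2) (A k 0 - b₀ * A k 2) _ _ (by rw [hq, hq]; ring)
          (abs_le.2 ⟨by linarith, by linarith⟩),
        bnd (A k' 1 - b₁ * A k' 2) (A k 1 - b₁ * A k 2) _ _ (by rw [hq, hq]; ring)
          (abs_le.2 ⟨by linarith, by linarith⟩),
        bnd (A k' 3 - b₃ * A k' 2 - ρ₀ * (A k' 0 - b₀ * A k' 2) - ρ₁ * (A k' 1 - b₁ * A k' 2))
          (A k 3 - b₃ * A k 2 - ρ₀ * (A k 0 - b₀ * A k 2) - ρ₁ * (A k 1 - b₁ * A k 2)) _ _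
          (by rw [hq, hq, hq, hq]; ring) (abs_le.2 ⟨by linarith, by linarith⟩)⟩
    · intro k' hk' k'' hk'' h
      refine boxPoint_injective b₀ b₁ b₃ ρ₀ ρ₁ (funext fun i => ?_)
      have := congrFun h i
      simp only at this
      simp only [Finset.coe_filter, Set.mem_ofPred_eq] at hk' hk''
      have h1 := Int.ediv_mul_cancel (hdiv k' hk'.2 i)
      have h2 := Int.ediv_mul_cancel (hdiv k'' hk''.2 i)
      rw [this] at h1
      have : A k' i - A k i = A k'' i - A k i := h1.symm.trans h2
      exact sub_left_inj.1 this

/-- Values, increments and first-order Taylor remainders of `x ↦ x ^ c` on a compact interval. -/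
theorem exists_rpow_bounds (c : ℝ) {L : ℝ} (hL : 1 ≤ L) : ∃ K : ℝ, 1 ≤ K ∧
    ∀ x ∈ Set.Icc L⁻¹ L, ∀ y ∈ Set.Icc L⁻¹ L, x ^ c ∈ Set.Icc K⁻¹ K ∧
      |x ^ c - y ^ c| ≤ K * |x - y| ∧
      |x ^ c - y ^ c - c * y ^ (c - 1) * (x - y)| ≤ K * (x - y) ^ 2 := by
  have hL0 : 0 < L := by linarith
  have hpos : ∀ x ∈ Set.Icc L⁻¹ L, 0 < x := fun x hx => (inv_pos.2 hL0).trans_le hx.1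
  have hup : ∀ (e : ℝ), ∀ x ∈ Set.Icc L⁻¹ L, x ^ e ≤ L ^ |e| := by
    intro e x hx
    rcases le_or_gt 0 e with he | he
    · rw [abs_of_nonneg he]
      exact rpow_le_rpow (hpos x hx).le hx.2 he
    · rw [abs_of_neg he, rpow_neg hL0.le, ← inv_rpow hL0.le]
      exact rpow_le_rpow_of_nonpos (inv_pos.2 hL0) hx.1 he.le
  have hlip : ∀ (e : ℝ), ∀ x ∈ Set.Icc L⁻¹ L, ∀ y ∈ Set.Icc L⁻¹ L,
      |x ^ e - y ^ e| ≤ |e| * L ^ |e - 1| * |x - y| := by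
    intro e x hx y hy
    refine (convex_Icc L⁻¹ L).norm_image_sub_le_of_norm_hasDerivWithin_le (f := fun t => t ^ e)
      (f' := fun t => e * t ^ (e - 1)) (fun t ht => ?_) (fun t ht => ?_) hy hx
    · exact (Real.hasDerivAt_rpow_const (Or.inl (hpos t ht).ne')).hasDerivWithinAt
    · rw [Real.norm_eq_abs, abs_mul, abs_of_nonneg (rpow_nonneg (hpos t ht).le _)]
      exact mul_le_mul_of_nonneg_left (hup _ t ht) (abs_nonneg _)
  refine ⟨L ^ |c| + |c| * L ^ |c - 1| + |c| * (|c - 1| * L ^ |c - 1 - 1|), ?_,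
    fun x hx y hy => ⟨⟨?_, ?_⟩, ?_, ?_⟩⟩
  · have := one_le_rpow hL (abs_nonneg c)
    have : 0 ≤ |c| * L ^ |c - 1| := by positivity
    have : 0 ≤ |c| * (|c - 1| * L ^ |c - 1 - 1|) := by positivity
    linarith
  · have h1 := hup (-c) x hx
    rw [rpow_neg (hpos x hx).le, abs_neg] at h1
    have h2 : 0 ≤ |c| * L ^ |c - 1| := by positivity
    have h3 : 0 ≤ |c| * (|c - 1| * L ^ |c - 1 - 1|) := by positivity
    exact inv_le_of_inv_le₀ (rpow_pos_of_pos (hpos x hx) _) (by linarith)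
  · have h1 := hup c x hx
    have h2 : 0 ≤ |c| * L ^ |c - 1| := by positivity
    have h3 : 0 ≤ |c| * (|c - 1| * L ^ |c - 1 - 1|) := by positivity
    linarith
  · refine (hlip c x hx y hy).trans (mul_le_mul_of_nonneg_right ?_ (abs_nonneg _))
    have h2 : 0 ≤ L ^ |c| := by positivity
    have h3 : 0 ≤ |c| * (|c - 1| * L ^ |c - 1 - 1|) := by positivity
    linarith
  · have hsub : Set.uIcc y x ⊆ Set.Icc L⁻¹ L := Set.uIcc_subset_Icc hy hx
    have := (convex_uIcc y x).norm_image_sub_le_of_norm_hasDerivWithin_le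
      (f := fun t => t ^ c - c * y ^ (c - 1) * t) (f' := fun t => c * t ^ (c - 1) -
        c * y ^ (c - 1)) (C := |c| * (|c - 1| * L ^ |c - 1 - 1|) * |x - y|)
      (fun t ht => ?_) (fun t ht => ?_) Set.left_mem_uIcc Set.right_mem_uIcc
    · rw [Real.norm_eq_abs, Real.norm_eq_abs, mul_assoc _ |x - y|, ← sq, sq_abs] at this
      have e : x ^ c - y ^ c - c * y ^ (c - 1) * (x - y) =
        x ^ c - c * y ^ (c - 1) * x - (y ^ c - c * y ^ (c - 1) * y) := by ring
      rw [e]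
      refine this.trans (mul_le_mul_of_nonneg_right ?_ (sq_nonneg _))
      have h2 : 0 ≤ L ^ |c| := by positivity
      have h3 : 0 ≤ |c| * L ^ |c - 1| := by positivity
      linarith
    · have h1 := (Real.hasDerivAt_rpow_const (p := c) (Or.inl (hpos t (hsub ht)).ne'))
      have h2 := (hasDerivAt_id t).const_mul (c * y ^ (c - 1))
      rw [mul_one] at h2
      exact (h1.sub h2).hasDerivWithinAt
    · rw [Real.norm_eq_abs, ← mul_sub, abs_mul, mul_assoc]
      refine mul_le_mul_of_nonneg_left ?_ (abs_nonneg _)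
      refine (hlip (c - 1) t (hsub ht) y hy).trans ?_
      refine mul_le_mul_of_nonneg_left ?_ (by positivity)
      exact Set.abs_sub_left_of_mem_uIcc ht

theorem exists_abs_sub_le_rpow {c : ℝ} (hc : c ≠ 0) {L : ℝ} (hL : 1 ≤ L) : ∃ K : ℝ, 1 ≤ K ∧
    ∀ x ∈ Set.Icc L⁻¹ L, ∀ y ∈ Set.Icc L⁻¹ L, |x - y| ≤ K * |x ^ c - y ^ c| := by
  obtain ⟨K, hK, h⟩ := exists_rpow_bounds c hL
  obtain ⟨K', hK', h'⟩ := exists_rpow_bounds c⁻¹ hK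
  refine ⟨K', hK', fun x hx y hy => ?_⟩
  have hpos : ∀ x ∈ Set.Icc L⁻¹ L, 0 ≤ x := fun x hx => (by positivity : 0 ≤ L⁻¹).trans hx.1
  have := (h' _ (h x hx y hy).1 _ (h y hy x hx).1).2.1
  rwa [← rpow_mul (hpos x hx), ← rpow_mul (hpos y hy), mul_inv_cancel₀ hc, rpow_one,
    rpow_one] at this

theorem mul_mem_Icc_inv {A B x y : ℝ} (hA : 1 ≤ A) (hB : 1 ≤ B) (hx : x ∈ Set.Icc A⁻¹ A)
    (hy : y ∈ Set.Icc B⁻¹ B) : x * y ∈ Set.Icc (A * B)⁻¹ (A * B) := by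
  have h1 : 0 < A⁻¹ := by positivity
  have h2 : 0 < B⁻¹ := by positivity
  refine ⟨?_, mul_le_mul hx.2 hy.2 (h2.le.trans hy.1) (by linarith)⟩
  rw [mul_inv]
  exact mul_le_mul hx.1 hy.1 h2.le (h1.le.trans hx.1)

theorem div_mem_Icc_inv {A B x y : ℝ} (hA : 1 ≤ A) (hB : 1 ≤ B) (hx : x ∈ Set.Icc A⁻¹ A)
    (hy : y ∈ Set.Icc B⁻¹ B) : x / y ∈ Set.Icc (A * B)⁻¹ (A * B) := by
  have h2 : 0 < B⁻¹ := by positivity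
  rw [div_eq_mul_inv]
  exact mul_mem_Icc_inv hA hB hx
    ⟨inv_anti₀ (h2.trans_le hy.1) hy.2, inv_le_of_inv_le₀ (by linarith) hy.1⟩

set_option maxHeartbeats 2000000 in
/-- Solutions of size about `1` in the same cell of width `r` lie in a common cap of the cone. -/
theorem exists_normalized_geometry {c : ℝ} (hc : c ≠ 0) {L : ℝ} (hL : 1 ≤ L) : ∃ C : ℝ, 1 ≤ C ∧
    ∀ r : ℝ, 0 < r → r ≤ 1 → ∀ x y : Fin 4 → ℝ, (∀ j, x j ∈ Set.Icc L⁻¹ L) →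
      (∀ j, y j ∈ Set.Icc L⁻¹ L) →
      |x 0 ^ c + x 1 ^ c - x 2 ^ c - x 3 ^ c| ≤ r ^ 2 →
      |y 0 ^ c + y 1 ^ c - y 2 ^ c - y 3 ^ c| ≤ r ^ 2 →
      |x 0 / x 3 - y 0 / y 3| ≤ r → |x 1 / x 3 - y 1 / y 3| ≤ r →
      |(y 0 / y 2) ^ (c - 1) * x 0 + (y 1 / y 2) ^ (c - 1) * x 1 - x 2 -
          (y 3 / y 2) ^ (c - 1) * x 3| ≤ C * r ^ 2 ∧
        |x 0 - y 0 / y 3 * x 3| ≤ C * r ∧ |x 1 - y 1 / y 3 * x 3| ≤ C * r := by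
  have hLL : 1 ≤ L * L := by nlinarith
  have hLLL : 1 ≤ L * L * L := by nlinarith
  obtain ⟨K₁, hK₁, h₁⟩ := exists_rpow_bounds c hLLL
  obtain ⟨K₂, hK₂, h₂⟩ := exists_rpow_bounds (c - 1) hLLL
  obtain ⟨K₃, hK₃, h₃⟩ := exists_abs_sub_le_rpow hc hLLL
  have hsub : Set.Icc L⁻¹ L ⊆ Set.Icc (L * L * L)⁻¹ (L * L * L) :=
    Set.Icc_subset_Icc (inv_anti₀ (by linarith) (by nlinarith)) (by nlinarith)
  have hsub2 : Set.Icc (L * L)⁻¹ (L * L) ⊆ Set.Icc (L * L * L)⁻¹ (L * L * L) :=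
    Set.Icc_subset_Icc (inv_anti₀ (by linarith) (by nlinarith)) (by nlinarith)
  have hpos : ∀ x ∈ Set.Icc L⁻¹ L, 0 < x := fun x hx =>
    (by positivity : 0 < L⁻¹).trans_le hx.1
  -- bound for the transversal displacement
  obtain ⟨T, hT⟩ : ∃ T, T = K₃ * (1 + K₁ + 2 * K₁ * L) + L := ⟨_, rfl⟩
  have hT0 : 0 ≤ T := by rw [hT]; positivity
  refine ⟨L + |c|⁻¹ * K₂ * K₂ * (1 + K₁ + 3 * K₁ * T ^ 2) + L * L * K₁ * K₂, ?_, ?_⟩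
  · have : 0 ≤ |c|⁻¹ * K₂ * K₂ * (1 + K₁ + 3 * K₁ * T ^ 2) + L * L * K₁ * K₂ := by positivity
    linarith
  intro r hr hr1 x y hx hy hFx hFy h0 h1
  have hx0 := fun j => hpos _ (hx j)
  have hy0 := fun j => hpos _ (hy j)
  set q := x 3 / y 3 with hq
  have hqm : q ∈ Set.Icc (L * L)⁻¹ (L * L) := div_mem_Icc_inv hL hL (hx 3) (hy 3)
  have hq0 : 0 < q := div_pos (hx0 3) (hy0 3)
  have hqy : ∀ j, q * y j ∈ Set.Icc (L * L * L)⁻¹ (L * L * L) := fun j =>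
    mul_mem_Icc_inv hLL hL hqm (hy j)
  have hr2 : r ^ 2 ≤ r := by nlinarith
  have τ0 : |x 0 - q * y 0| ≤ L * r := by
    have e : x 0 - q * y 0 = x 3 * (x 0 / x 3 - y 0 / y 3) := by
      rw [hq]; field_simp [(hx0 3).ne', (hy0 3).ne']
    rw [e, abs_mul, abs_of_pos (hx0 3)]
    exact mul_le_mul (hx 3).2 h0 (abs_nonneg _) (by linarith)
  have τ1 : |x 1 - q * y 1| ≤ L * r := by
    have e : x 1 - q * y 1 = x 3 * (x 1 / x 3 - y 1 / y 3) := by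
      rw [hq]; field_simp [(hx0 3).ne', (hy0 3).ne']
    rw [e, abs_mul, abs_of_pos (hx0 3)]
    exact mul_le_mul (hx 3).2 h1 (abs_nonneg _) (by linarith)
  have τ3 : q * y 3 = x 3 := by rw [hq]; field_simp [(hy0 3).ne']
  have hqc : q ^ c ≤ K₁ := (h₁ q (hsub2 hqm) q (hsub2 hqm)).1.2
  have hqc0 : 0 < q ^ c := rpow_pos_of_pos hq0 c
  have hmul : ∀ j, (q * y j) ^ c = q ^ c * y j ^ c := fun j => mul_rpow hq0.le (hy0 j).le
  have hFq : |(q * y 0) ^ c + (q * y 1) ^ c - (q * y 2) ^ c - x 3 ^ c| ≤ K₁ * r ^ 2 := by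
    have e : (q * y 0) ^ c + (q * y 1) ^ c - (q * y 2) ^ c - x 3 ^ c =
        q ^ c * (y 0 ^ c + y 1 ^ c - y 2 ^ c - y 3 ^ c) := by
      rw [← τ3, hmul, hmul, hmul, hmul]; ring
    rw [e, abs_mul, abs_of_pos hqc0]
    exact mul_le_mul hqc hFy (abs_nonneg _) (by linarith)
  have d0 := (h₁ _ (hsub (hx 0)) _ (hqy 0)).2
  have d1 := (h₁ _ (hsub (hx 1)) _ (hqy 1)).2
  have d2 := (h₁ _ (hsub (hx 2)) _ (hqy 2)).2
  have τ2 : |x 2 - q * y 2| ≤ T * r := by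
    have hd : |x 2 ^ c - (q * y 2) ^ c| ≤ (1 + K₁ + 2 * K₁ * L) * r := by
      have e0 : |x 0 ^ c - (q * y 0) ^ c| ≤ K₁ * (L * r) :=
        d0.1.trans (mul_le_mul_of_nonneg_left τ0 (by linarith))
      have e1 : |x 1 ^ c - (q * y 1) ^ c| ≤ K₁ * (L * r) :=
        d1.1.trans (mul_le_mul_of_nonneg_left τ1 (by linarith))
      have : K₁ * r ^ 2 ≤ K₁ * r := mul_le_mul_of_nonneg_left hr2 (by linarith)
      rw [abs_le] at *
      constructor <;> linarith
    refine (h₃ _ (hsub (hx 2)) _ (hqy 2)).trans ?_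
    refine (mul_le_mul_of_nonneg_left hd (by linarith)).trans ?_
    have : 0 ≤ L * r := by positivity
    rw [hT]
    linarith
  have hLT : L * r ≤ T * r := by
    refine mul_le_mul_of_nonneg_right ?_ hr.le
    have : 0 ≤ K₃ * (1 + K₁ + 2 * K₁ * L) := by positivity
    linarith
  have sqb : ∀ t, |t| ≤ T * r → K₁ * t ^ 2 ≤ K₁ * (T ^ 2 * r ^ 2) := fun t ht => by
    rw [← sq_abs, ← mul_pow]
    gcongr
  have t0 := d0.2.trans (sqb _ (τ0.trans hLT))
  have t1 := d1.2.trans (sqb _ (τ1.trans hLT))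
  have t2 := d2.2.trans (sqb _ τ2)
  have hmul' : ∀ j, (q * y j) ^ (c - 1) = q ^ (c - 1) * y j ^ (c - 1) := fun j =>
    mul_rpow hq0.le (hy0 j).le
  set S := y 0 ^ (c - 1) * (x 0 - q * y 0) + y 1 ^ (c - 1) * (x 1 - q * y 1) -
    y 2 ^ (c - 1) * (x 2 - q * y 2) with hS
  have hq1 : q ^ (c - 1) ∈ Set.Icc K₂⁻¹ K₂ := (h₂ q (hsub2 hqm) q (hsub2 hqm)).1
  have hy2 : y 2 ^ (c - 1) ∈ Set.Icc K₂⁻¹ K₂ := (h₂ _ (hsub (hy 2)) _ (hsub (hy 2))).1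
  have hK₂i : 0 < K₂⁻¹ := by positivity
  have hSb : |S| ≤ |c|⁻¹ * K₂ * (1 + K₁ + 3 * K₁ * T ^ 2) * r ^ 2 := by
    have h5 : |c * q ^ (c - 1) * S| ≤ (1 + K₁ + 3 * K₁ * T ^ 2) * r ^ 2 := by
      rw [hmul'] at t0 t1 t2
      rw [hS]
      rw [abs_le] at hFx hFq t0 t1 t2 ⊢
      constructor <;> linarith
    rw [abs_mul, abs_mul, abs_of_pos (hK₂i.trans_le hq1.1)] at h5
    have hc0 : 0 < |c| := abs_pos.2 hc
    have h6 : |c| * K₂⁻¹ * |S| ≤ (1 + K₁ + 3 * K₁ * T ^ 2) * r ^ 2 := by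
      refine le_trans ?_ h5
      gcongr
      exact hq1.1
    have h7 := mul_le_mul_of_nonneg_left h6 (by positivity : 0 ≤ |c|⁻¹ * K₂)
    have e : |c|⁻¹ * K₂ * (|c| * K₂⁻¹ * |S|) = |S| := by
      field_simp
    rw [e] at h7
    linarith
  have hfin : 0 ≤ |c|⁻¹ * K₂ * K₂ * (1 + K₁ + 3 * K₁ * T ^ 2) + L * L * K₁ * K₂ := by
    positivity
  refine ⟨?_, ?_, ?_⟩
  · have hdiv : ∀ j, (y j / y 2) ^ (c - 1) = y j ^ (c - 1) / y 2 ^ (c - 1) := fun j =>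
      div_rpow (hy0 j).le (hy0 2).le _
    have hyy : ∀ j, y j ^ (c - 1) * y j = y j ^ c := fun j => by
      rw [rpow_sub_one (hy0 j).ne']
      field_simp [(hy0 j).ne']
    have hy2p : 0 < y 2 ^ (c - 1) := hK₂i.trans_le hy2.1
    have e : (y 0 / y 2) ^ (c - 1) * x 0 + (y 1 / y 2) ^ (c - 1) * x 1 - x 2 -
          (y 3 / y 2) ^ (c - 1) * x 3 =
        (S + q * (y 0 ^ c + y 1 ^ c - y 2 ^ c - y 3 ^ c)) * (y 2 ^ (c - 1))⁻¹ := by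
      rw [hdiv, hdiv, hdiv, hS, ← hyy, ← hyy, ← hyy, ← hyy, ← τ3]
      field_simp
      ring
    rw [e, abs_mul, abs_of_pos (inv_pos.2 hy2p)]
    have hi : (y 2 ^ (c - 1))⁻¹ ≤ K₂ := inv_le_of_inv_le₀ (by linarith) hy2.1
    have h8 : |S + q * (y 0 ^ c + y 1 ^ c - y 2 ^ c - y 3 ^ c)| ≤
        |c|⁻¹ * K₂ * (1 + K₁ + 3 * K₁ * T ^ 2) * r ^ 2 + L * L * K₁ * r ^ 2 := by
      refine (abs_add_le _ _).trans (add_le_add hSb ?_)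
      rw [abs_mul, abs_of_pos hq0]
      have : L * L * r ^ 2 ≤ L * L * K₁ * r ^ 2 := by
        refine mul_le_mul_of_nonneg_right ?_ (sq_nonneg _)
        nlinarith
      exact (mul_le_mul hqm.2 hFy (abs_nonneg _) (by linarith)).trans this
    refine (mul_le_mul h8 hi (inv_nonneg.2 hy2p.le) (by positivity)).trans ?_
    have : 0 ≤ L * r ^ 2 := by positivity
    linarith
  · have e : x 0 - y 0 / y 3 * x 3 = x 0 - q * y 0 := by rw [hq]; ring
    rw [e]
    exact τ0.trans (mul_le_mul_of_nonneg_right (by linarith) hr.le)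
  · have e : x 1 - y 1 / y 3 * x 3 = x 1 - q * y 1 := by rw [hq]; ring
    rw [e]
    exact τ1.trans (mul_le_mul_of_nonneg_right (by linarith) hr.le)

set_option maxHeartbeats 1000000 in
/-- The normalised dual points near the gradient ray of a solution are almost solutions of the
equation with the conjugate exponent, and they determine the solution up to scaling. -/
theorem exists_normalized_dual {c c' : ℝ} (hcc : (c - 1) * (c' - 1) = 1)
    {L : ℝ} (hL : 1 ≤ L) : ∃ σ : ℝ, 0 < σ ∧ ∃ C : ℝ, 1 ≤ C ∧ ∃ L' : ℝ, 1 ≤ L' ∧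
    ∀ r η : ℝ, 0 < r → r ≤ η → η ≤ 1 → ∀ y : Fin 4 → ℝ, (∀ j, y j ∈ Set.Icc L⁻¹ L) →
      |y 0 ^ c + y 1 ^ c - y 2 ^ c - y 3 ^ c| ≤ r ^ 2 → ∀ z₀ z₁ z₃ : ℝ,
      |z₀ - (y 0 / y 2) ^ (c - 1)| ≤ σ * η → |z₁ - (y 1 / y 2) ^ (c - 1)| ≤ σ * η →
      |z₃ - (y 3 / y 2) ^ (c - 1) - y 0 / y 3 * (z₀ - (y 0 / y 2) ^ (c - 1)) -
        y 1 / y 3 * (z₁ - (y 1 / y 2) ^ (c - 1))| ≤ σ * η ^ 2 →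
      (z₀ ∈ Set.Icc L'⁻¹ L' ∧ z₁ ∈ Set.Icc L'⁻¹ L' ∧ z₃ ∈ Set.Icc L'⁻¹ L') ∧
        |z₀ ^ c' + z₁ ^ c' - 1 - z₃ ^ c'| ≤ C * η ^ 2 ∧
        |y 0 / y 3 - (z₀ / z₃) ^ (c' - 1)| ≤ C * η ∧
        |y 1 / y 3 - (z₁ / z₃) ^ (c' - 1)| ≤ C * η := by
  have hLL : 1 ≤ L * L := by nlinarith
  obtain ⟨B, hB, h₁⟩ := exists_rpow_bounds (c - 1) hLL
  obtain ⟨K₁, hK₁, hc⟩ := exists_rpow_bounds c hL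
  have h2B : 1 ≤ 2 * B := by linarith
  have h4B : 1 ≤ 2 * B * (2 * B) := by nlinarith
  obtain ⟨K, hK, h₂⟩ := exists_rpow_bounds c' h2B
  obtain ⟨K₃, hK₃, h₃⟩ := exists_rpow_bounds (c' - 1) h4B
  have hsub : Set.Icc L⁻¹ L ⊆ Set.Icc (L * L)⁻¹ (L * L) :=
    Set.Icc_subset_Icc (inv_anti₀ (by linarith) (by nlinarith)) (by nlinarith)
  have hsubB : Set.Icc B⁻¹ B ⊆ Set.Icc (2 * B)⁻¹ (2 * B) :=
    Set.Icc_subset_Icc (inv_anti₀ (by linarith) (by nlinarith)) (by nlinarith)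
  have hsubBB : Set.Icc (B * B)⁻¹ (B * B) ⊆ Set.Icc (2 * B * (2 * B))⁻¹ (2 * B * (2 * B)) :=
    Set.Icc_subset_Icc (inv_anti₀ (by positivity) (by nlinarith)) (by nlinarith)
  obtain ⟨σ, hσdef⟩ : ∃ σ, σ = 1 / (6 * (L * L) * B) := ⟨_, rfl⟩
  have hσ : 0 < σ := by rw [hσdef]; positivity
  have hσB : 3 * (L * L) * σ = 1 / (2 * B) := by rw [hσdef]; field_simp; norm_num
  have h2Bi : 1 / (2 * B) ≤ 1 := by rw [div_le_one (by linarith)]; linarith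
  have hσ1 : σ ≤ 1 := by nlinarith
  refine ⟨σ, hσ, 3 * K + K₁ + |c'| * (L * L) + K₃ * (4 * B ^ 3), ?_, 2 * B, h2B, ?_⟩
  · have : 0 ≤ |c'| * (L * L) + K₃ * (4 * B ^ 3) := by positivity
    linarith
  intro r η hr hrη hη y hy hF z₀ z₁ z₃ hz₀ hz₁ hz₃
  have hη0 : 0 < η := hr.trans_le hrη
  have hy0 : ∀ j, 0 < y j := fun j => (by positivity : 0 < L⁻¹).trans_le (hy j).1
  have hyy : ∀ i j, y i / y j ∈ Set.Icc (L * L)⁻¹ (L * L) := fun i j =>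
    div_mem_Icc_inv hL hL (hy i) (hy j)
  have hyp : ∀ i j, 0 < y i / y j := fun i j => div_pos (hy0 i) (hy0 j)
  have hb : ∀ j, (y j / y 2) ^ (c - 1) ∈ Set.Icc B⁻¹ B := fun j => (h₁ _ (hyy j 2) _ (hyy j 2)).1
  have hbp : ∀ j, 0 < (y j / y 2) ^ (c - 1) := fun j => rpow_pos_of_pos (hyp j 2) _
  have hb1 : ∀ j, ((y j / y 2) ^ (c - 1)) ^ (c' - 1) = y j / y 2 := fun j => by
    rw [← rpow_mul (hyp j 2).le, hcc, rpow_one]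
  have hbc : ∀ j, ((y j / y 2) ^ (c - 1)) ^ c' = (y j / y 2) ^ c := fun j => by
    rw [← rpow_mul (hyp j 2).le]
    congr 1
    linarith
  have hb03 : ∀ j, ((y j / y 2) ^ (c - 1) / (y 3 / y 2) ^ (c - 1)) ^ (c' - 1) = y j / y 3 :=
    fun j => by
      rw [div_rpow (hbp j).le (hbp 3).le, hb1, hb1]
      field_simp [(hy0 2).ne', (hy0 3).ne']
  obtain ⟨b₀, hb₀⟩ : ∃ b, b = (y 0 / y 2) ^ (c - 1) := ⟨_, rfl⟩
  obtain ⟨b₁, hb₁⟩ : ∃ b, b = (y 1 / y 2) ^ (c - 1) := ⟨_, rfl⟩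
  obtain ⟨b₃, hb₃⟩ : ∃ b, b = (y 3 / y 2) ^ (c - 1) := ⟨_, rfl⟩
  have m0 := hb 0
  have m1 := hb 1
  have m3 := hb 3
  have e0 := hb1 0
  have e1 := hb1 1
  have e3 := hb1 3
  have f0 := hbc 0
  have f1 := hbc 1
  have f3 := hbc 3
  have g0 := hb03 0
  have g1 := hb03 1
  rw [← hb₀] at hz₀ hz₃ m0 e0 f0 g0
  rw [← hb₁] at hz₁ hz₃ m1 e1 f1 g1
  rw [← hb₃] at hz₃ m3 e3 f3 g0 g1
  have hση : σ * η ≤ η / (2 * B) := by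
    rw [div_eq_mul_one_div, mul_comm η]
    exact mul_le_mul_of_nonneg_right (by nlinarith) hη0.le
  have w0 : |z₀ - b₀| ≤ η / (2 * B) := hz₀.trans hση
  have w1 : |z₁ - b₁| ≤ η / (2 * B) := hz₁.trans hση
  have w3 : |z₃ - b₃| ≤ η / (2 * B) := by
    have e : z₃ - b₃ = (z₃ - b₃ - y 0 / y 3 * (z₀ - b₀) - y 1 / y 3 * (z₁ - b₁)) +
        y 0 / y 3 * (z₀ - b₀) + y 1 / y 3 * (z₁ - b₁) := by ring
    have k0 : |y 0 / y 3 * (z₀ - b₀)| ≤ L * L * (σ * η) := by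
      rw [abs_mul, abs_of_pos (hyp 0 3)]
      exact mul_le_mul (hyy 0 3).2 hz₀ (abs_nonneg _) (by linarith)
    have k1 : |y 1 / y 3 * (z₁ - b₁)| ≤ L * L * (σ * η) := by
      rw [abs_mul, abs_of_pos (hyp 1 3)]
      exact mul_le_mul (hyy 1 3).2 hz₁ (abs_nonneg _) (by linarith)
    have k3 : σ * η ^ 2 ≤ L * L * (σ * η) := by
      have : σ * η ^ 2 ≤ σ * η := mul_le_mul_of_nonneg_left (by nlinarith) hσ.le
      have : 0 < σ * η := by positivity
      nlinarith
    have k4 : η / (2 * B) = 3 * (L * L * (σ * η)) := by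
      rw [div_eq_mul_one_div, ← hσB]; ring
    rw [e, k4]
    refine (abs_add_le _ _).trans ?_
    have := abs_add_le (z₃ - b₃ - y 0 / y 3 * (z₀ - b₀) - y 1 / y 3 * (z₁ - b₁))
      (y 0 / y 3 * (z₀ - b₀))
    linarith
  have hmem : ∀ z b, b ∈ Set.Icc B⁻¹ B → |z - b| ≤ η / (2 * B) →
      z ∈ Set.Icc (2 * B)⁻¹ (2 * B) := by
    intro z b hb hz
    have h5 : η / (2 * B) ≤ 1 / (2 * B) := by gcongr
    have h6 : B⁻¹ = 2 * (1 / (2 * B)) := by field_simp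
    rw [abs_le] at hz
    rw [← one_div]
    constructor
    · have := hb.1
      linarith
    · have := hb.2
      linarith
  have n0 := hmem _ _ m0 w0
  have n1 := hmem _ _ m1 w1
  have n3 := hmem _ _ m3 w3
  have hηB : η / (2 * B) ≤ η := by
    rw [div_le_iff₀ (by linarith)]
    nlinarith
  have sqb : ∀ t, |t| ≤ η / (2 * B) → K * t ^ 2 ≤ K * η ^ 2 := fun t ht => by
    rw [← sq_abs]
    have := ht.trans hηB
    gcongr
  have hK0 : 0 < K := by linarith
  have hrη2 : r ^ 2 ≤ η ^ 2 := by gcongr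
  have hη2 : 0 < η ^ 2 := by positivity
  have hK₃0 : 0 < K₃ := by linarith
  refine ⟨⟨n0, n1, n3⟩, ?_, ?_⟩
  · have t0 := (h₂ _ n0 _ (hsubB m0)).2.2.trans (sqb _ w0)
    have t1 := (h₂ _ n1 _ (hsubB m1)).2.2.trans (sqb _ w1)
    have t3 := (h₂ _ n3 _ (hsubB m3)).2.2.trans (sqb _ w3)
    rw [e0, f0] at t0
    rw [e1, f1] at t1
    rw [e3, f3] at t3
    have p : |(y 0 / y 2) ^ c + (y 1 / y 2) ^ c - 1 - (y 3 / y 2) ^ c| ≤ K₁ * η ^ 2 := by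
      have hy2 := (hc _ (hy 2) _ (hy 2)).1.1
      have hy2p : 0 < y 2 ^ c := rpow_pos_of_pos (hy0 2) _
      have e : (y 0 / y 2) ^ c + (y 1 / y 2) ^ c - 1 - (y 3 / y 2) ^ c =
          (y 2 ^ c)⁻¹ * (y 0 ^ c + y 1 ^ c - y 2 ^ c - y 3 ^ c) := by
        rw [div_rpow (hy0 _).le (hy0 _).le, div_rpow (hy0 _).le (hy0 _).le,
          div_rpow (hy0 _).le (hy0 _).le]
        field_simp
      rw [e, abs_mul, abs_of_pos (inv_pos.2 hy2p)]
      exact mul_le_mul (inv_le_of_inv_le₀ (by linarith) hy2) (hF.trans hrη2) (abs_nonneg _)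
        (by linarith)
    have lin : |c' * (y 3 / y 2) * (z₃ - b₃ - y 0 / y 3 * (z₀ - b₀) - y 1 / y 3 * (z₁ - b₁))| ≤
        |c'| * (L * L) * η ^ 2 := by
      rw [abs_mul, abs_mul, abs_of_pos (hyp 3 2)]
      refine mul_le_mul (mul_le_mul_of_nonneg_left (hyy 3 2).2 (abs_nonneg _))
        (hz₃.trans ?_) (abs_nonneg _) (by positivity)
      nlinarith
    have e : c' * (y 3 / y 2) * (z₃ - b₃ - y 0 / y 3 * (z₀ - b₀) - y 1 / y 3 * (z₁ - b₁)) =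
        c' * (y 3 / y 2) * (z₃ - b₃) - c' * (y 0 / y 2) * (z₀ - b₀) -
          c' * (y 1 / y 2) * (z₁ - b₁) := by
      field_simp [(hy0 2).ne', (hy0 3).ne']
    rw [e] at lin
    have hr : 0 ≤ K₃ * (4 * B ^ 3) * η ^ 2 := by positivity
    rw [abs_le] at t0 t1 t3 p lin ⊢
    constructor <;> linarith
  · have quot : ∀ z b, b ∈ Set.Icc B⁻¹ B → z ∈ Set.Icc (2 * B)⁻¹ (2 * B) →
        |z - b| ≤ η / (2 * B) →
        |(b / b₃) ^ (c' - 1) - (z / z₃) ^ (c' - 1)| ≤ K₃ * (4 * B ^ 3) * η := by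
      intro z b hb hz hzb
      refine (h₃ _ (hsubBB (div_mem_Icc_inv hB hB hb m3)) _
        (div_mem_Icc_inv h2B h2B hz n3)).2.1.trans ?_
      rw [mul_assoc]
      refine mul_le_mul_of_nonneg_left ?_ hK₃0.le
      have hBi : 0 < B⁻¹ := by positivity
      have hb3p : 0 < b₃ := hBi.trans_le m3.1
      have hz3p : 0 < z₃ := (by positivity : 0 < (2 * B)⁻¹).trans_le n3.1
      have e : b / b₃ - z / z₃ = (b * (z₃ - b₃) - (z - b) * b₃) * (b₃⁻¹ * z₃⁻¹) := by
        field_simp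
        ring
      have i3 : b₃⁻¹ ≤ B := inv_le_of_inv_le₀ (by linarith) m3.1
      have j3 : z₃⁻¹ ≤ 2 * B := inv_le_of_inv_le₀ (by linarith) n3.1
      rw [e, abs_mul, abs_of_pos (by positivity : 0 < b₃⁻¹ * z₃⁻¹)]
      have k1 : |b * (z₃ - b₃) - (z - b) * b₃| ≤ 2 * B * η := by
        refine (abs_sub _ _).trans ?_
        rw [abs_mul, abs_mul, abs_of_pos hb3p, abs_of_pos (hBi.trans_le hb.1)]
        have := mul_le_mul hb.2 (w3.trans hηB) (abs_nonneg _) (by linarith)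
        have := mul_le_mul (hzb.trans hηB) m3.2 hb3p.le hη0.le
        linarith
      have k2 : b₃⁻¹ * z₃⁻¹ ≤ B * (2 * B) := mul_le_mul i3 j3 (by positivity) (by linarith)
      refine (mul_le_mul k1 k2 (by positivity) (by positivity)).trans (le_of_eq ?_)
      ring
    have hle : K₃ * (4 * B ^ 3) * η ≤
        (3 * K + K₁ + |c'| * (L * L) + K₃ * (4 * B ^ 3)) * η := by
      refine mul_le_mul_of_nonneg_right ?_ hη0.le
      have : 0 ≤ |c'| * (L * L) := by positivity
      linarith
    rw [← g0, ← g1]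
    exact ⟨(quot _ _ m0 n0 w0).trans hle, (quot _ _ m1 n1 w1).trans hle⟩

/-- Integer quadruples of size about `M` with `|m₀ ^ c + m₁ ^ c - m₂ ^ c - m₃ ^ c| ≤ δ M ^ c`. -/
def nearSols (c L M δ : ℝ) : Set (Fin 4 → ℤ) :=
  {m | (∀ j, M / L ≤ m j ∧ (m j : ℝ) ≤ L * M) ∧
    |(m 0 : ℝ) ^ c + (m 1 : ℝ) ^ c - (m 2 : ℝ) ^ c - (m 3 : ℝ) ^ c| ≤ δ * M ^ c}

/-- Dual points of the cap of the cone of solutions around the solution `y`. -/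
def IsCapDual (c r M σ : ℝ) (y a : Fin 4 → ℤ) : Prop :=
  IsDualPoint ((y 0 / y 2 : ℝ) ^ (c - 1)) ((y 1 / y 2 : ℝ) ^ (c - 1))
    ((y 3 / y 2 : ℝ) ^ (c - 1)) (y 0 / y 3) (y 1 / y 3) (σ / (r ^ 2 * M)) (σ / (r * M)) (σ / M) a

theorem div_mem_of_mem_nearSols {c L M δ : ℝ} (hL : 1 ≤ L) (hM : 0 < M) {m : Fin 4 → ℤ}
    (hm : m ∈ nearSols c L M δ) :
    (∀ j, (m j / M : ℝ) ∈ Set.Icc L⁻¹ L) ∧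
      |(m 0 / M : ℝ) ^ c + (m 1 / M : ℝ) ^ c - (m 2 / M : ℝ) ^ c - (m 3 / M : ℝ) ^ c| ≤ δ := by
  obtain ⟨h1, h2⟩ := hm
  have h0 : ∀ j, (0 : ℝ) ≤ m j := fun j => le_trans (by positivity) (h1 j).1
  refine ⟨fun j => ⟨?_, ?_⟩, ?_⟩
  · rw [le_div_iff₀ hM]
    have := (h1 j).1
    rwa [div_eq_inv_mul] at this
  · rw [div_le_iff₀ hM]
    exact (h1 j).2
  · have hMc : 0 < M ^ c := rpow_pos_of_pos hM c
    rw [div_rpow (h0 0) hM.le, div_rpow (h0 1) hM.le, div_rpow (h0 2) hM.le, div_rpow (h0 3) hM.le,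
      ← add_div, ← sub_div, ← sub_div, abs_div, abs_of_pos hMc, div_le_iff₀ hMc]
    exact h2

theorem exists_cap_geometry {c : ℝ} (hc : c ≠ 0) {L : ℝ} (hL : 1 ≤ L) : ∃ C : ℝ, 1 ≤ C ∧
    ∀ M r : ℝ, 0 < M → 0 < r → r ≤ 1 → ∀ x ∈ nearSols c L M (r ^ 2),
      ∀ y ∈ nearSols c L M (r ^ 2),
      |(x 0 / x 3 - y 0 / y 3 : ℝ)| ≤ r → |(x 1 / x 3 - y 1 / y 3 : ℝ)| ≤ r →
      |(y 0 / y 2 : ℝ) ^ (c - 1) * x 0 + (y 1 / y 2 : ℝ) ^ (c - 1) * x 1 - x 2 -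
          (y 3 / y 2 : ℝ) ^ (c - 1) * x 3| ≤ C * (r ^ 2 * M) ∧
        |(x 0 - y 0 / y 3 * x 3 : ℝ)| ≤ C * (r * M) ∧
        |(x 1 - y 1 / y 3 * x 3 : ℝ)| ≤ C * (r * M) := by
  obtain ⟨C, hC, h⟩ := exists_normalized_geometry hc hL
  refine ⟨C, hC, fun M r hM hr hr1 x hx y hy h0 h1 => ?_⟩
  obtain ⟨hx1, hx2⟩ := div_mem_of_mem_nearSols hL hM hx
  obtain ⟨hy1, hy2⟩ := div_mem_of_mem_nearSols hL hM hy
  have hdd : ∀ s t : ℝ, s / M / (t / M) = s / t := fun s t => div_div_div_cancel_right₀ hM.ne' s t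
  have := h r hr hr1 (fun j => x j / M) (fun j => y j / M) hx1 hy1 hx2 hy2
    (by simpa only [hdd] using h0) (by simpa only [hdd] using h1)
  simp only [hdd] at this
  obtain ⟨a1, a2, a3⟩ := this
  refine ⟨?_, ?_, ?_⟩
  · have e : (y 0 / y 2 : ℝ) ^ (c - 1) * x 0 + (y 1 / y 2 : ℝ) ^ (c - 1) * x 1 - x 2 -
          (y 3 / y 2 : ℝ) ^ (c - 1) * x 3 = ((y 0 / y 2 : ℝ) ^ (c - 1) * (x 0 / M) +
          (y 1 / y 2 : ℝ) ^ (c - 1) * (x 1 / M) - x 2 / M -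
          (y 3 / y 2 : ℝ) ^ (c - 1) * (x 3 / M)) * M := by
      field_simp
    rw [e, abs_mul, abs_of_pos hM, ← mul_assoc]
    exact mul_le_mul_of_nonneg_right a1 hM.le
  · have e : (x 0 - y 0 / y 3 * x 3 : ℝ) = (x 0 / M - y 0 / y 3 * (x 3 / M)) * M := by
      field_simp
    rw [e, abs_mul, abs_of_pos hM, ← mul_assoc]
    exact mul_le_mul_of_nonneg_right a2 hM.le
  · have e : (x 1 - y 1 / y 3 * x 3 : ℝ) = (x 1 / M - y 1 / y 3 * (x 3 / M)) * M := by
      field_simp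
    rw [e, abs_mul, abs_of_pos hM, ← mul_assoc]
    exact mul_le_mul_of_nonneg_right a3 hM.le

theorem exists_cap_dual {c c' : ℝ} (hcc : (c - 1) * (c' - 1) = 1)
    {L : ℝ} (hL : 1 ≤ L) : ∃ σ₀ : ℝ, 0 < σ₀ ∧ ∃ C : ℝ, 1 ≤ C ∧ ∃ L' : ℝ, 1 ≤ L' ∧
    ∀ M r σ P : ℝ, 0 < M → 0 < r → 1 ≤ r * M → 0 < σ → σ ≤ σ₀ → σ ≤ 1 → 0 < P →
      ∀ y ∈ nearSols c L M (r ^ 2), ∀ a : Fin 4 → ℤ, IsCapDual c r M σ y a → 1 ≤ a 2 →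
      P ≤ a 2 → (a 2 : ℝ) ≤ 2 * P →
      a ∈ nearSols c' L' P (C / (r * M * P) ^ 2) ∧
        |(y 0 / y 3 - (a 0 / a 3 : ℝ) ^ (c' - 1) : ℝ)| ≤ C / (r * M * P) ∧
        |(y 1 / y 3 - (a 1 / a 3 : ℝ) ^ (c' - 1) : ℝ)| ≤ C / (r * M * P) := by
  obtain ⟨σ₀, hσ₀, C, hC, L', hL', h⟩ := exists_normalized_dual hcc hL
  obtain ⟨K, hK, hc'⟩ := exists_rpow_bounds c' (one_le_two)
  refine ⟨σ₀, hσ₀, C * K, by nlinarith, 2 * L', by linarith, ?_⟩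
  intro M r σ P hM hr hrM hσ hσσ hσ1 hP y hy a ⟨d2, d0, d1, d3⟩ ha hPa haP
  have hA : (1 : ℝ) ≤ a 2 := by exact_mod_cast ha
  have hA0 : (0 : ℝ) < a 2 := by linarith
  have hrM0 : 0 < r * M := by positivity
  have hr2M : 0 < r ^ 2 * M := by positivity
  rw [abs_of_pos hA0, le_div_iff₀ hr2M] at d2
  obtain ⟨hy1, hy2⟩ := div_mem_of_mem_nearSols hL hM hy
  have hdd : ∀ s t : ℝ, s / M / (t / M) = s / t := fun s t => div_div_div_cancel_right₀ hM.ne' s t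
  obtain ⟨η, hη⟩ : ∃ η, η = 1 / (r * M * a 2) := ⟨_, rfl⟩
  have hη0 : 0 < η := by rw [hη]; positivity
  have hη1 : η ≤ 1 := by
    rw [hη, div_le_one (by positivity)]
    nlinarith
  have hrη : r ≤ η := by
    rw [hη, le_div_iff₀ (by positivity)]
    linarith
  have hηP : η ≤ 1 / (r * M * P) := by rw [hη]; gcongr
  have scale : ∀ s t : ℝ, |s| ≤ t → |s / a 2| ≤ t / a 2 := fun s t hst => by
    rw [abs_div, abs_of_pos hA0]
    gcongr
  have key := h r η hr hrη hη1 (fun j => y j / M) hy1 hy2 (a 0 / a 2) (a 1 / a 2) (a 3 / a 2)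
  simp only [hdd] at key
  have hu : σ / (r * M) / a 2 ≤ σ₀ * η := by
    have : σ / (r * M) / a 2 = σ * η := by rw [hη]; field_simp
    rw [this]
    exact mul_le_mul_of_nonneg_right hσσ hη0.le
  have hw : σ / M / a 2 ≤ σ₀ * η ^ 2 := by
    have : σ / M / a 2 = σ * η ^ 2 * (a 2 * (r ^ 2 * M)) := by rw [hη]; field_simp
    rw [this]
    have h5 : σ * η ^ 2 ≤ σ₀ * η ^ 2 := mul_le_mul_of_nonneg_right hσσ (by positivity)
    have h6 : 0 < σ * η ^ 2 := by positivity
    nlinarith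
  have g0 : |(a 0 / a 2 : ℝ) - (y 0 / y 2 : ℝ) ^ (c - 1)| ≤ σ₀ * η := by
    refine le_trans (le_of_eq ?_) ((scale _ _ d0).trans hu)
    congr 1
    field_simp
  have g1 : |(a 1 / a 2 : ℝ) - (y 1 / y 2 : ℝ) ^ (c - 1)| ≤ σ₀ * η := by
    refine le_trans (le_of_eq ?_) ((scale _ _ d1).trans hu)
    congr 1
    field_simp
  have g3 : |(a 3 / a 2 : ℝ) - (y 3 / y 2 : ℝ) ^ (c - 1) -
      y 0 / y 3 * ((a 0 / a 2 : ℝ) - (y 0 / y 2 : ℝ) ^ (c - 1)) -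
      y 1 / y 3 * ((a 1 / a 2 : ℝ) - (y 1 / y 2 : ℝ) ^ (c - 1))| ≤ σ₀ * η ^ 2 := by
    refine le_trans (le_of_eq ?_) ((scale _ _ d3).trans hw)
    congr 1
    field_simp
  obtain ⟨⟨z0, z1, z3⟩, hE, hr0, hr1⟩ := key g0 g1 g3
  have hd2 : ∀ s t : ℝ, s / a 2 / (t / a 2) = s / t := fun s t =>
    div_div_div_cancel_right₀ hA0.ne' s t
  rw [hd2] at hr0 hr1
  have hCη : C * η ≤ C * K / (r * M * P) := by
    rw [mul_div_assoc, div_eq_mul_one_div K]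
    refine mul_le_mul_of_nonneg_left ?_ (by linarith)
    nlinarith
  have hL'0 : 0 < L' := by linarith
  have size : ∀ t : ℝ, t / a 2 ∈ Set.Icc L'⁻¹ L' → P / (2 * L') ≤ t ∧ t ≤ 2 * L' * P := by
    rintro t ⟨t1, t2⟩
    rw [div_le_iff₀ hA0] at t2
    rw [le_div_iff₀ hA0] at t1
    constructor
    · refine le_trans ?_ t1
      rw [div_le_iff₀ (by positivity)]
      have : L'⁻¹ * a 2 * (2 * L') = 2 * a 2 := by field_simp
      rw [this]
      linarith
    · nlinarith
  have hLinv : L'⁻¹ ≤ 1 := inv_le_one_of_one_le₀ hL'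
  have s0 := size _ z0
  have s1 := size _ z1
  have s2 := size (a 2) (by rw [div_self hA0.ne']; exact ⟨hLinv, hL'⟩)
  have s3 := size _ z3
  have hlow : 0 < P / (2 * L') := by positivity
  have pos0 : (0 : ℝ) ≤ a 0 := hlow.le.trans s0.1
  have pos1 : (0 : ℝ) ≤ a 1 := hlow.le.trans s1.1
  have pos3 : (0 : ℝ) ≤ a 3 := hlow.le.trans s3.1
  refine ⟨⟨?_, ?_⟩, hr0.trans hCη, hr1.trans hCη⟩
  · intro j
    fin_cases j
    exacts [s0, s1, s2, s3]
  · have hac : (0 : ℝ) < (a 2 : ℝ) ^ c' := rpow_pos_of_pos hA0 _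
    have e : (a 0 : ℝ) ^ c' + (a 1 : ℝ) ^ c' - (a 2 : ℝ) ^ c' - (a 3 : ℝ) ^ c' =
        ((a 0 / a 2 : ℝ) ^ c' + (a 1 / a 2 : ℝ) ^ c' - 1 - (a 3 / a 2 : ℝ) ^ c') *
          (a 2 : ℝ) ^ c' := by
      rw [div_rpow pos0 hA0.le, div_rpow pos1 hA0.le, div_rpow pos3 hA0.le]
      field_simp
    rw [e, abs_mul, abs_of_pos hac]
    have hK2 : (a 2 : ℝ) ^ c' ≤ K * P ^ c' := by
      have hm : (a 2 / P : ℝ) ∈ Set.Icc (2 : ℝ)⁻¹ 2 := by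
        constructor
        · rw [le_div_iff₀ hP]; linarith
        · rw [div_le_iff₀ hP]; exact haP
      have := (hc' _ hm _ hm).1.2
      rwa [div_rpow hA0.le hP.le, div_le_iff₀ (rpow_pos_of_pos hP _)] at this
    refine (mul_le_mul hE hK2 hac.le (by positivity)).trans ?_
    have h7 : η ^ 2 ≤ 1 / (r * M * P) ^ 2 := by
      have := pow_le_pow_left₀ hη0.le hηP 2
      rwa [div_pow, one_pow] at this
    have h8 : 0 ≤ C * K * P ^ c' := by positivity
    calc C * η ^ 2 * (K * P ^ c') = C * K * P ^ c' * η ^ 2 := by ring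
      _ ≤ C * K * P ^ c' * (1 / (r * M * P) ^ 2) := mul_le_mul_of_nonneg_left h7 h8
      _ = _ := by ring

theorem card_le_of_abs_sub_le (S : Finset (ℤ × ℤ)) {R₀ R₁ t : ℝ} (ht : 0 ≤ t)
    (h : ∀ k ∈ S, |k.1 - R₀| ≤ t ∧ |k.2 - R₁| ≤ t) : (S.card : ℝ) ≤ (2 * t + 1) ^ 2 := by
  have hI : ∀ R : ℝ, ((Finset.Icc ⌈R - t⌉ ⌊R + t⌋).card : ℝ) ≤ 2 * t + 1 := by
    intro R
    rw [Int.card_Icc]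
    have h1 := Int.floor_le (R + t)
    have h2 := Int.le_ceil (R - t)
    have h3 : ((⌊R + t⌋ + 1 - ⌈R - t⌉).toNat : ℤ) = max (⌊R + t⌋ + 1 - ⌈R - t⌉) 0 :=
      Int.ofNat_toNat _
    have h4 : ((⌊R + t⌋ + 1 - ⌈R - t⌉).toNat : ℝ) =
        max ((⌊R + t⌋ : ℝ) + 1 - ⌈R - t⌉) 0 := by exact_mod_cast h3
    rw [h4]
    exact max_le (by linarith) (by linarith)
  have hsub : S ⊆ Finset.Icc ⌈R₀ - t⌉ ⌊R₀ + t⌋ ×ˢ Finset.Icc ⌈R₁ - t⌉ ⌊R₁ + t⌋ := by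
    intro k hk
    obtain ⟨h0, h1⟩ := h k hk
    rw [abs_le] at h0 h1
    simp only [Finset.mem_product, Finset.mem_Icc, Int.ceil_le, Int.le_floor]
    refine ⟨⟨?_, ?_⟩, ⟨?_, ?_⟩⟩ <;> linarith
  have := Finset.card_le_card hsub
  rw [Finset.card_product] at this
  refine (Nat.cast_le.2 this).trans ?_
  push_cast
  rw [sq]
  exact mul_le_mul (hI _) (hI _) (Nat.cast_nonneg _) (by linarith)

theorem nearSols_subset_box {c L M δ : ℝ} (hL : 1 ≤ L) (hM : 0 < M) :
    nearSols c L M δ ⊆ (Fintype.piFinset fun _ : Fin 4 => Finset.Icc (1 : ℤ) ⌊L * M⌋ :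
      Finset (Fin 4 → ℤ)) := by
  intro m hm
  simp only [Finset.mem_coe, Fintype.mem_piFinset, Finset.mem_Icc]
  intro j
  have h1 := hm.1 j
  have h2 : (0 : ℝ) < m j := lt_of_lt_of_le (by positivity) h1.1
  exact ⟨by exact_mod_cast h2, Int.le_floor.2 h1.2⟩

theorem nearSols_finite {c L M δ : ℝ} (hL : 1 ≤ L) (hM : 0 < M) : (nearSols c L M δ).Finite :=
  (Finset.finite_toSet _).subset (nearSols_subset_box hL hM)

/-- The trivial bound. -/
theorem ncard_nearSols_le {c L M δ : ℝ} (hL : 1 ≤ L) (hM : 0 < M) :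
    ((nearSols c L M δ).ncard : ℝ) ≤ (L * M) ^ 4 := by
  have h := Set.ncard_le_ncard (nearSols_subset_box (c := c) (δ := δ) hL hM)
    (Finset.finite_toSet _)
  rw [Set.ncard_coe_finset, Fintype.card_piFinset_const, Int.card_Icc] at h
  refine (Nat.cast_le.2 h).trans ?_
  push_cast
  have h0 : 0 ≤ L * M := by positivity
  gcongr
  have h3 : ((⌊L * M⌋ + 1 - 1).toNat : ℤ) = ⌊L * M⌋ := by
    rw [add_sub_cancel_right]
    exact Int.toNat_of_nonneg (Int.floor_nonneg.2 h0)
  have h4 : ((⌊L * M⌋ + 1 - 1).toNat : ℝ) = (⌊L * M⌋ : ℝ) := by exact_mod_cast h3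
  rw [h4]
  exact Int.floor_le _

theorem exists_sum_dyadic_le {κ : ℝ} (hκ : 0 < κ) : ∃ C : ℝ, 0 < C ∧ ∀ N : ℝ, 0 < N →
    ∑ i ∈ Finset.range (Nat.log 2 ⌊N⌋₊ + 1), ((2 : ℝ) ^ i) ^ κ ≤ C * (1 + N ^ κ) := by
  have hq : 1 < (2 : ℝ) ^ κ := one_lt_rpow one_lt_two hκ
  refine ⟨2 ^ κ / (2 ^ κ - 1), div_pos (by linarith) (by linarith), fun N hN => ?_⟩
  have hpow : ∀ i : ℕ, ((2 : ℝ) ^ i) ^ κ = ((2 : ℝ) ^ κ) ^ i := fun i => by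
    rw [← rpow_natCast, ← rpow_natCast, ← rpow_mul zero_le_two, ← rpow_mul zero_le_two, mul_comm]
  have hn : ((2 : ℝ) ^ κ) ^ Nat.log 2 ⌊N⌋₊ ≤ 1 + N ^ κ := by
    have hNκ : 0 < N ^ κ := rpow_pos_of_pos hN κ
    rcases Nat.eq_zero_or_pos ⌊N⌋₊ with h | h
    · rw [h]; simp; linarith
    · have h1 : ((2 ^ Nat.log 2 ⌊N⌋₊ : ℕ) : ℝ) ≤ N :=
        (Nat.cast_le.2 (Nat.pow_log_le_self 2 h.ne')).trans (Nat.floor_le hN.le)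
      push_cast at h1
      rw [← hpow]
      have := rpow_le_rpow (by positivity) h1 hκ.le
      linarith
  simp_rw [hpow]
  rw [geom_sum_eq hq.ne', div_mul_eq_mul_div]
  refine div_le_div_of_nonneg_right ?_ (by linarith)
  rw [pow_succ]
  nlinarith

/-- Coordinates of the cell containing the quadruple `m`. -/
noncomputable def cellIndex (r : ℝ) (m : Fin 4 → ℤ) : ℤ × ℤ :=
  (⌊(m 0 / m 3 : ℝ) / r⌋, ⌊(m 1 / m 3 : ℝ) / r⌋)

theorem abs_sub_le_of_cellIndex_eq {r : ℝ} (hr : 0 < r) {x y : Fin 4 → ℤ}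
    (h : cellIndex r x = cellIndex r y) :
    |(x 0 / x 3 - y 0 / y 3 : ℝ)| ≤ r ∧ |(x 1 / x 3 - y 1 / y 3 : ℝ)| ≤ r := by
  have aux : ∀ s t : ℝ, ⌊s / r⌋ = ⌊t / r⌋ → |s - t| ≤ r := fun s t hst => by
    have := (Int.abs_sub_lt_one_of_floor_eq_floor hst).le
    rwa [← sub_div, abs_div, abs_of_pos hr, div_le_one hr] at this
  exact ⟨aux _ _ (congrArg Prod.fst h), aux _ _ (congrArg Prod.snd h)⟩

theorem abs_floor_div_sub_le {r : ℝ} (hr : 0 < r) {q R t : ℝ} (h : |q - R| ≤ t) :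
    |(⌊q / r⌋ : ℝ) - R / r| ≤ t / r + 1 := by
  have h1 := Int.floor_le (q / r)
  have h2 := Int.lt_floor_add_one (q / r)
  have h3 : |q / r - R / r| ≤ t / r := by
    rw [← sub_div, abs_div, abs_of_pos hr]
    gcongr
  rw [abs_le] at *
  constructor <;> linarith

theorem IsCapDual.neg {c r M σ : ℝ} {y a : Fin 4 → ℤ} (h : IsCapDual c r M σ y a) :
    IsCapDual c r M σ y (-a) := by
  obtain ⟨h2, h0, h1, h3⟩ := h
  refine ⟨?_, ?_, ?_, ?_⟩
  · rwa [Pi.neg_apply, Int.cast_neg, abs_neg]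
  · rw [← abs_neg]
    convert h0 using 2
    simp
    ring
  · rw [← abs_neg]
    convert h1 using 2
    simp
    ring
  · rw [← abs_neg]
    convert h3 using 2
    simp
    ring

theorem IsCapDual.eq_zero {c r M σ : ℝ} {y a : Fin 4 → ℤ} (h : IsCapDual c r M σ y a)
    (hσ : σ < 1) (hM : 1 ≤ M) (hrM : 1 ≤ r * M) (ha : a 2 = 0) : a = 0 := by
  obtain ⟨-, h0, h1, h3⟩ := h
  have hzero : ∀ (n : ℤ) (t : ℝ), 1 ≤ t → |(n : ℝ)| ≤ σ / t → n = 0 := by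
    intro n t ht hn
    rw [le_div_iff₀ (by linarith)] at hn
    have h5 : |(n : ℝ)| < 1 := by nlinarith [abs_nonneg (n : ℝ)]
    exact Int.abs_lt_one_iff.1 (by exact_mod_cast h5)
  simp only [ha, Int.cast_zero, mul_zero, sub_zero] at h0 h1 h3
  have e0 := hzero _ _ hrM h0
  have e1 := hzero _ _ hrM h1
  simp only [e0, e1, Int.cast_zero, mul_zero, sub_zero] at h3
  have e3 := hzero _ _ hM h3
  funext j
  fin_cases j
  exacts [e0, e1, ha, e3]

/-- The solutions in one cell are bounded by the dual points of its cap, listed dyadically. -/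
theorem card_mul_le_of_isCapDual {c r M σ : ℝ} {y : Fin 4 → ℤ} (X : Finset (Fin 4 → ℤ))
    (D : ℕ → Finset (Fin 4 → ℤ)) (hr : 0 < r) (hM : 1 ≤ M) (hrM : 1 ≤ r * M) (hσ : 0 < σ)
    (hσ1 : σ < 1) {C : ℝ} (hC : σ * C ≤ 1 / 64)
    (h₂ : ∀ x ∈ X, |(y 0 / y 2 : ℝ) ^ (c - 1) * x 0 + (y 1 / y 2 : ℝ) ^ (c - 1) * x 1 - x 2 -
          (y 3 / y 2 : ℝ) ^ (c - 1) * x 3| ≤ C * (r ^ 2 * M))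
    (h₀ : ∀ x ∈ X, |(x 0 - y 0 / y 3 * x 3 : ℝ)| ≤ C * (r * M))
    (h₁ : ∀ x ∈ X, |(x 1 - y 1 / y 3 * x 3 : ℝ)| ≤ C * (r * M))
    (h₃ : ∀ x ∈ X, |(x 3 : ℝ)| ≤ C * M)
    (hD : ∀ a i, IsCapDual c r M σ y a → 1 ≤ a 2 → (2 : ℝ) ^ i ≤ a 2 → (a 2 : ℝ) ≤ 2 * 2 ^ i →
      a ∈ D i) :
    (X.card : ℝ) * (σ ^ 4 / (r ^ 4 * M ^ 4)) ≤
      64 * (1 + 2 * ∑ i ∈ Finset.range (Nat.log 2 ⌊1 / (r ^ 2 * M)⌋₊ + 1), ((D i).card : ℝ)) := by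
  classical
  have hM0 : 0 < M := by linarith
  have hrM0 : 0 < r * M := by positivity
  have hr2M : 0 < r ^ 2 * M := by positivity
  set n := Nat.log 2 ⌊1 / (r ^ 2 * M)⌋₊ with hn
  let T := (Finset.range (n + 1)).biUnion D
  let K := insert 0 (T ∪ T.image Neg.neg)
  have hpos : ∀ a, IsCapDual c r M σ y a → 1 ≤ a 2 → a ∈ T := by
    intro a ha ha2
    obtain ⟨m, hm⟩ := Int.eq_ofNat_of_zero_le (by omega : 0 ≤ a 2)
    have hm0 : m ≠ 0 := by omega
    have hmr : (a 2 : ℝ) = m := by rw [hm]; simp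
    have h1 : ((2 ^ Nat.log 2 m : ℕ) : ℝ) ≤ m := Nat.cast_le.2 (Nat.pow_log_le_self 2 hm0)
    have h2 : (m : ℝ) ≤ ((2 ^ (Nat.log 2 m + 1) : ℕ) : ℝ) :=
      Nat.cast_le.2 (Nat.lt_pow_succ_log_self one_lt_two m).le
    push_cast at h1 h2
    refine Finset.mem_biUnion.2 ⟨Nat.log 2 m, ?_, hD a _ ha ha2 (by rw [hmr]; exact h1)
      (by rw [hmr]; rw [pow_succ] at h2; linarith)⟩
    rw [Finset.mem_range, Nat.lt_succ_iff]
    refine Nat.log_mono_right (Nat.le_floor ?_)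
    rw [← hmr]
    refine (le_abs_self _).trans (ha.1.trans ?_)
    gcongr
  have hK : ∀ a, IsCapDual c r M σ y a → a ∈ K := by
    intro a ha
    simp only [K, Finset.mem_insert, Finset.mem_union, Finset.mem_image]
    rcases lt_trichotomy (a 2) 0 with h | h | h
    · exact Or.inr (Or.inr ⟨-a, hpos _ ha.neg (by rw [Pi.neg_apply]; omega), neg_neg a⟩)
    · exact Or.inl (ha.eq_zero hσ1 hM hrM h)
    · exact Or.inr (Or.inl (hpos a ha (by omega)))
  have hbound : ∀ s t : ℝ, 0 < t → s ≤ C * t → σ / t * s ≤ 1 / 64 := fun s t ht hs => by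
    refine le_trans ?_ hC
    rw [div_mul_eq_mul_div, div_le_iff₀ ht]
    nlinarith
  have main := card_mul_volume_le_of_dual X K (div_pos hσ hr2M) (div_pos hσ hrM0)
    (div_pos hσ hM0) (fun x hx => hbound _ _ hr2M (h₂ x hx))
    (fun x hx => hbound _ _ hrM0 (h₀ x hx)) (fun x hx => hbound _ _ hrM0 (h₁ x hx))
    (fun x hx => hbound _ _ hM0 (h₃ x hx)) hK
  have hvol : σ / (r ^ 2 * M) * (σ / (r * M)) ^ 2 * (σ / M) = σ ^ 4 / (r ^ 4 * M ^ 4) := by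
    field_simp
  rw [hvol] at main
  refine main.trans (mul_le_mul_of_nonneg_left ?_ (by norm_num))
  have hT : (T.card : ℝ) ≤ ∑ i ∈ Finset.range (n + 1), ((D i).card : ℝ) := by
    exact_mod_cast Finset.card_biUnion_le
  have hKT : (K.card : ℝ) ≤ 1 + 2 * T.card := by
    have h1 := Finset.card_insert_le 0 (T ∪ T.image Neg.neg)
    have h2 := Finset.card_union_le T (T.image Neg.neg)
    have h3 : (T.image Neg.neg).card ≤ T.card := Finset.card_image_le
    have : K.card ≤ 1 + 2 * T.card := by simp only [K]; omega
    exact_mod_cast this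
  linarith

/-- The number of solutions is bounded with a loss of `M ^ κ` over the diagonal term `M ^ 2`. -/
def EnergyBound (c κ : ℝ) : Prop :=
  ∀ L : ℝ, 1 ≤ L → ∃ C : ℝ, 0 < C ∧ ∀ M : ℝ, 1 ≤ M → ∀ δ : ℝ, 0 < δ →
    ((nearSols c L M δ).ncard : ℝ) ≤ C * (M ^ (2 + κ) + δ * M ^ 4)

set_option maxHeartbeats 1000000 in
/-- A bound for the conjugate exponent controls the solutions through the dual points of caps of
angular width `r`. -/
theorem EnergyBound.exists_ncard_le_of_dual {c c' κ : ℝ} (hc : c ≠ 0)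
    (hcc : (c - 1) * (c' - 1) = 1) (hκ : 0 < κ) (hE : EnergyBound c' κ) {L : ℝ} (hL : 1 ≤ L) :
    ∃ C : ℝ, 0 < C ∧ ∀ M r : ℝ, 1 ≤ M → 0 < r → r ≤ 1 → 1 ≤ r * M →
      ((nearSols c L M (r ^ 2)).ncard : ℝ) ≤
        C * (r ^ 2 * M ^ 4 + M ^ 2 * (1 / (r ^ 2 * M)) ^ κ) := by
  classical
  obtain ⟨G, hG, hgeom⟩ := exists_cap_geometry hc hL
  obtain ⟨σ₀, hσ₀, A, hA, L', hL', hdual⟩ := exists_cap_dual hcc hL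
  obtain ⟨E, hE0, hEb⟩ := hE L' hL'
  obtain ⟨S, hS, hsum⟩ := exists_sum_dyadic_le hκ
  obtain ⟨σ, hσdef⟩ : ∃ σ, σ = min σ₀ (1 / (64 * (G + L))) := ⟨_, rfl⟩
  have hσ : 0 < σ := by rw [hσdef]; exact lt_min hσ₀ (by positivity)
  have hσσ₀ : σ ≤ σ₀ := by rw [hσdef]; exact min_le_left _ _
  have hσC : σ * (G + L) ≤ 1 / 64 := by
    have : σ ≤ 1 / (64 * (G + L)) := by rw [hσdef]; exact min_le_right _ _
    rw [le_div_iff₀ (by positivity)] at this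
    linarith
  have hσ1 : σ < 1 := by nlinarith
  refine ⟨64 / σ ^ 4 * (25 * (L * L) ^ 2 + 2 * (E * (1 + A) * (2 * A + 3) ^ 2 * S)), by positivity,
    fun M r hM hr hr1 hrM => ?_⟩
  have hM0 : 0 < M := by linarith
  have hrM0 : 0 < r * M := by positivity
  have hr2M : 0 < r ^ 2 * M := by positivity
  obtain ⟨N, hN⟩ : ∃ N, N = 1 / (r ^ 2 * M) := ⟨_, rfl⟩
  have hN0 : 0 < N := by rw [hN]; positivity
  obtain ⟨n, hn⟩ : ∃ n, n = Nat.log 2 ⌊N⌋₊ := ⟨_, rfl⟩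
  let X := (nearSols_finite (c := c) (δ := r ^ 2) hL hM0).toFinset
  have hX : ∀ x, x ∈ X ↔ x ∈ nearSols c L M (r ^ 2) := fun x => Set.Finite.mem_toFinset _
  let Q := X.image (cellIndex r)
  have hbase : ∀ k : ℤ × ℤ, ∃ y, k ∈ Q → y ∈ nearSols c L M (r ^ 2) ∧ cellIndex r y = k := by
    intro k
    by_cases hk : k ∈ Q
    · obtain ⟨y, hy, rfl⟩ := Finset.mem_image.1 hk
      exact ⟨y, fun _ => ⟨(hX y).1 hy, rfl⟩⟩
    · exact ⟨0, fun h => absurd h hk⟩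
  choose y hy using hbase
  let D : ℕ → Finset (Fin 4 → ℤ) := fun i => (nearSols_finite (c := c')
    (δ := A / (r * M * 2 ^ i) ^ 2) hL' (by positivity : (0 : ℝ) < 2 ^ i)).toFinset
  let R : ℕ → ℤ × ℤ → (Fin 4 → ℤ) → Prop := fun i k a =>
    IsCapDual c r M σ (y k) a ∧ 1 ≤ a 2 ∧ (2 : ℝ) ^ i ≤ a 2 ∧ (a 2 : ℝ) ≤ 2 * 2 ^ i
  have hdual' : ∀ k ∈ Q, ∀ i a, R i k a → a ∈ nearSols c' L' (2 ^ i) (A / (r * M * 2 ^ i) ^ 2) ∧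
      |((y k) 0 / (y k) 3 - (a 0 / a 3 : ℝ) ^ (c' - 1) : ℝ)| ≤ A / (r * M * 2 ^ i) ∧
      |((y k) 1 / (y k) 3 - (a 1 / a 3 : ℝ) ^ (c' - 1) : ℝ)| ≤ A / (r * M * 2 ^ i) :=
    fun k hk i a h => hdual M r σ (2 ^ i) hM0 hr hrM hσ hσσ₀ hσ1.le (by positivity) (y k)
      (hy k hk).1 a h.1 h.2.1 h.2.2.1 h.2.2.2
  -- each cell is controlled by the dual points at its base point
  have hcell : ∀ k ∈ Q, ((X.filter fun x => cellIndex r x = k).card : ℝ) *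
      (σ ^ 4 / (r ^ 4 * M ^ 4)) ≤
      64 * (1 + 2 * ∑ i ∈ Finset.range (n + 1), (((D i).filter (R i k)).card : ℝ)) := by
    intro k hk
    obtain ⟨hyk, hyk'⟩ := hy k hk
    have hg : ∀ x ∈ X.filter fun x => cellIndex r x = k, _ := fun x hx =>
      hgeom M r hM0 hr hr1 x ((hX x).1 (Finset.mem_filter.1 hx).1) (y k) hyk
        (abs_sub_le_of_cellIndex_eq hr ((Finset.mem_filter.1 hx).2.trans hyk'.symm)).1
        (abs_sub_le_of_cellIndex_eq hr ((Finset.mem_filter.1 hx).2.trans hyk'.symm)).2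
    have hGL : ∀ t : ℝ, 0 ≤ t → G * t ≤ (G + L) * t := fun t ht => by nlinarith
    rw [hn, hN]
    refine card_mul_le_of_isCapDual _ _ hr hM hrM hσ hσ1 hσC
      (fun x hx => (hg x hx).1.trans (hGL _ hr2M.le))
      (fun x hx => (hg x hx).2.1.trans (hGL _ hrM0.le))
      (fun x hx => (hg x hx).2.2.trans (hGL _ hrM0.le)) (fun x hx => ?_)
      (fun a i ha h1 h2 h3 => ?_)
    · have hx' := ((hX x).1 (Finset.mem_filter.1 hx).1).1 3
      have h0 : (0 : ℝ) ≤ x 3 := le_trans (by positivity) hx'.1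
      rw [abs_of_nonneg h0]
      nlinarith [hx'.2]
    · exact Finset.mem_filter.2 ⟨(Set.Finite.mem_toFinset _).2
        (hdual' k hk i a ⟨ha, h1, h2, h3⟩).1, ha, h1, h2, h3⟩
  -- every dual point serves few cells
  have hmult : ∀ i, ∀ a, ((Q.filter fun k => R i k a).card : ℝ) ≤
      ((2 * A + 3) / (r ^ 2 * M * 2 ^ i)) ^ 2 := by
    intro i a
    rcases (Q.filter fun k => R i k a).eq_empty_or_nonempty with h | ⟨k₀, hk₀⟩
    · rw [h]
      simp
      positivity
    have h1 : 1 ≤ 1 / (r ^ 2 * M * 2 ^ i) := by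
      obtain ⟨hd, ha1, ha2, -⟩ := (Finset.mem_filter.1 hk₀).2
      have h2 := (ha2.trans (le_abs_self _)).trans hd.1
      rw [le_div_iff₀ hr2M] at h2
      rw [le_div_iff₀ (by positivity)]
      linarith
    have ht : A / (r * M * 2 ^ i) / r + 1 ≤ (A + 1) * (1 / (r ^ 2 * M * 2 ^ i)) := by
      have : A / (r * M * 2 ^ i) / r = A * (1 / (r ^ 2 * M * 2 ^ i)) := by field_simp
      rw [this]
      linarith
    have ht0 : 0 ≤ A / (r * M * 2 ^ i) / r + 1 := by positivity
    refine (card_le_of_abs_sub_le (R₀ := (a 0 / a 3 : ℝ) ^ (c' - 1) / r)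
      (R₁ := (a 1 / a 3 : ℝ) ^ (c' - 1) / r) _ ht0 fun k hk => ?_).trans ?_
    · obtain ⟨hkQ, hkR⟩ := Finset.mem_filter.1 hk
      obtain ⟨-, q0, q1⟩ := hdual' k hkQ i a hkR
      have e := (hy k hkQ).2
      rw [← congrArg Prod.fst e, ← congrArg Prod.snd e]
      exact ⟨abs_floor_div_sub_le hr q0, abs_floor_div_sub_le hr q1⟩
    · rw [div_eq_mul_one_div (2 * A + 3)]
      generalize A / (r * M * 2 ^ i) / r + 1 = t at *
      refine pow_le_pow_left₀ (by linarith) ?_ 2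
      linarith
  have hQ : (Q.card : ℝ) ≤ 25 * (L * L) ^ 2 / r ^ 2 := by
    have hq : ∀ x ∈ nearSols c L M (r ^ 2), ∀ j, |(x j / x 3 : ℝ) - 0| ≤ L * L := by
      intro x hx j
      have hm := div_mem_of_mem_nearSols hL hM0 hx
      have := div_mem_Icc_inv hL hL (hm.1 j) (hm.1 3)
      rw [div_div_div_cancel_right₀ hM0.ne'] at this
      rw [sub_zero, abs_of_nonneg ((by positivity : 0 ≤ (L * L)⁻¹).trans this.1)]
      exact this.2
    refine (card_le_of_abs_sub_le Q (R₀ := 0 / r) (R₁ := 0 / r) (t := L * L / r + 1)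
      (by positivity) fun k hk => ?_).trans ?_
    · obtain ⟨x, hx, rfl⟩ := Finset.mem_image.1 hk
      exact ⟨abs_floor_div_sub_le hr (hq x ((hX x).1 hx) 0),
        abs_floor_div_sub_le hr (hq x ((hX x).1 hx) 1)⟩
    · have h1 : 1 ≤ L * L / r := by
        rw [one_le_div hr]
        nlinarith
      have e : 25 * (L * L) ^ 2 / r ^ 2 = (5 * (L * L / r)) ^ 2 := by
        field_simp
        norm_num
      rw [e]
      refine pow_le_pow_left₀ (by positivity) (by linarith) 2
  have hDi : ∀ i, ((D i).card : ℝ) * ((2 * A + 3) / (r ^ 2 * M * 2 ^ i)) ^ 2 ≤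
      E * (1 + A) * (2 * A + 3) ^ 2 / (r ^ 2 * M) ^ 2 * ((2 : ℝ) ^ i) ^ κ := by
    intro i
    obtain ⟨p, hp⟩ : ∃ p, p = (2 : ℝ) ^ i := ⟨_, rfl⟩
    have hp1 : 1 ≤ p := by rw [hp]; exact one_le_pow₀ one_le_two
    have hp0 : 0 < p := by linarith
    have h1 : ((D i).card : ℝ) ≤ E * (p ^ 2 * p ^ κ + A / (r * M * p) ^ 2 * p ^ 4) := by
      have h2 : (nearSols c' L' (2 ^ i) (A / (r * M * 2 ^ i) ^ 2)).ncard = (D i).card :=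
        Set.ncard_eq_toFinset_card _ _
      rw [← h2, hp, ← rpow_two ((2 : ℝ) ^ i), ← rpow_add (by positivity)]
      exact hEb _ (by rw [← hp]; exact hp1) _ (by positivity)
    rw [← hp]
    have h3 : 1 ≤ p ^ κ := one_le_rpow hp1 hκ.le
    have h4 : A / (r * M) ^ 2 ≤ A * p ^ κ := by
      rw [div_le_iff₀ (by positivity)]
      have : 1 ≤ (r * M) ^ 2 := one_le_pow₀ hrM
      have : 1 ≤ p ^ κ * (r * M) ^ 2 := by nlinarith
      nlinarith
    calc ((D i).card : ℝ) * ((2 * A + 3) / (r ^ 2 * M * p)) ^ 2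
        ≤ E * (p ^ 2 * p ^ κ + A / (r * M * p) ^ 2 * p ^ 4) *
            ((2 * A + 3) / (r ^ 2 * M * p)) ^ 2 := mul_le_mul_of_nonneg_right h1 (sq_nonneg _)
      _ = E * (2 * A + 3) ^ 2 / (r ^ 2 * M) ^ 2 * (p ^ κ + A / (r * M) ^ 2) := by
        field_simp
      _ ≤ E * (2 * A + 3) ^ 2 / (r ^ 2 * M) ^ 2 * (p ^ κ + A * p ^ κ) := by gcongr
      _ = _ := by ring
  have hcount : ∑ k ∈ Q, ∑ i ∈ Finset.range (n + 1), (((D i).filter (R i k)).card : ℝ) ≤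
      E * (1 + A) * (2 * A + 3) ^ 2 * S / (r ^ 2 * M) ^ 2 * (1 + N ^ κ) := by
    rw [Finset.sum_comm]
    have hi : ∀ i ∈ Finset.range (n + 1), ∑ k ∈ Q, (((D i).filter (R i k)).card : ℝ) ≤
        E * (1 + A) * (2 * A + 3) ^ 2 / (r ^ 2 * M) ^ 2 * ((2 : ℝ) ^ i) ^ κ := by
      intro i _
      refine le_trans ?_ (hDi i)
      have := Finset.sum_card_bipartiteAbove_eq_sum_card_bipartiteBelow (s := Q) (t := D i) (R i)
      have h2 : ∑ k ∈ Q, (((D i).filter (R i k)).card : ℝ) =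
          ∑ a ∈ D i, ((Q.filter fun k => R i k a).card : ℝ) := by exact_mod_cast this
      rw [h2, ← nsmul_eq_mul]
      exact Finset.sum_le_card_nsmul _ _ _ fun a _ => hmult i a
    refine (Finset.sum_le_sum hi).trans ?_
    rw [← Finset.mul_sum]
    have := hsum N hN0
    rw [← hn] at this
    refine (mul_le_mul_of_nonneg_left this (by positivity)).trans (le_of_eq ?_)
    ring
  have htotal : (X.card : ℝ) * (σ ^ 4 / (r ^ 4 * M ^ 4)) ≤
      64 * (25 * (L * L) ^ 2 / r ^ 2 +
        2 * (E * (1 + A) * (2 * A + 3) ^ 2 * S / (r ^ 2 * M) ^ 2 * (1 + N ^ κ))) := by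
    have h1 : (X.card : ℝ) = ∑ k ∈ Q, ((X.filter fun x => cellIndex r x = k).card : ℝ) := by
      exact_mod_cast Finset.card_eq_sum_card_image (cellIndex r) X
    rw [h1, Finset.sum_mul]
    refine (Finset.sum_le_sum hcell).trans ?_
    rw [← Finset.mul_sum, Finset.sum_add_distrib, ← Finset.mul_sum]
    simp only [Finset.sum_const, nsmul_eq_mul, mul_one]
    linarith
  have hcard : (nearSols c L M (r ^ 2)).ncard = X.card := Set.ncard_eq_toFinset_card _ _
  rw [hcard, ← hN]
  obtain ⟨W, hW⟩ : ∃ W, W = E * (1 + A) * (2 * A + 3) ^ 2 * S := ⟨_, rfl⟩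
  have hW0 : 0 < W := by rw [hW]; positivity
  rw [← hW] at htotal ⊢
  have hNκ : 0 < N ^ κ := rpow_pos_of_pos hN0 κ
  have hMM : M ^ 2 ≤ r ^ 2 * M ^ 4 := by
    have : 1 ≤ (r * M) ^ 2 := one_le_pow₀ hrM
    nlinarith [sq_nonneg M]
  have h2 := mul_le_mul_of_nonneg_right htotal
    (by positivity : 0 ≤ r ^ 4 * M ^ 4 / σ ^ 4)
  calc (X.card : ℝ) = X.card * (σ ^ 4 / (r ^ 4 * M ^ 4)) * (r ^ 4 * M ^ 4 / σ ^ 4) := by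
        field_simp
    _ ≤ _ := h2
    _ = 64 / σ ^ 4 * (25 * (L * L) ^ 2 * (r ^ 2 * M ^ 4) + 2 * W * (M ^ 2 + M ^ 2 * N ^ κ)) := by
        field_simp
    _ ≤ 64 / σ ^ 4 * (25 * (L * L) ^ 2 * (r ^ 2 * M ^ 4 + M ^ 2 * N ^ κ) +
          2 * W * (r ^ 2 * M ^ 4 + M ^ 2 * N ^ κ)) := by
        gcongr
        have : 0 ≤ M ^ 2 * N ^ κ := by positivity
        linarith
    _ = _ := by ring

theorem energyBound_two (c : ℝ) : EnergyBound c 2 := by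
  intro L hL
  refine ⟨L ^ 4, by positivity, fun M hM δ hδ => ?_⟩
  have hM0 : 0 < M := by linarith
  refine (ncard_nearSols_le hL hM0).trans ?_
  have e : M ^ (2 + 2 : ℝ) = M ^ 4 := by
    rw [← rpow_natCast]
    norm_num
  rw [e, mul_pow]
  have : 0 ≤ δ * M ^ 4 := by positivity
  gcongr
  linarith

/-- Duality converts the exponent `κ` for the conjugate form into `κ / (1 + κ)`. -/
theorem EnergyBound.of_dual {c c' κ : ℝ} (hc : c ≠ 0) (hcc : (c - 1) * (c' - 1) = 1)
    (hκ : 0 < κ) (hE : EnergyBound c' κ) : EnergyBound c (κ / (1 + κ)) := by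
  intro L hL
  obtain ⟨C, hC, h⟩ := hE.exists_ncard_le_of_dual hc hcc hκ hL
  refine ⟨2 * C + L ^ 4, by positivity, fun M hM δ hδ => ?_⟩
  have hM0 : 0 < M := by linarith
  obtain ⟨k, hk⟩ : ∃ k, k = κ / (1 + κ) := ⟨_, rfl⟩
  have hk0 : 0 < k := by rw [hk]; positivity
  have hk1 : (1 - k) * κ = k := by
    rw [hk]
    field_simp
    ring
  rw [← hk]
  obtain ⟨d, hd⟩ : ∃ d, d = max δ (M ^ (k - 2)) := ⟨_, rfl⟩
  have hδd : δ ≤ d := hd ▸ le_max_left _ _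
  have hMd : M ^ (k - 2) ≤ d := hd ▸ le_max_right _ _
  have hd0 : 0 < d := hδ.trans_le hδd
  have hp4 : M ^ (k - 2) * M ^ 4 = M ^ (2 + k) := by
    rw [← rpow_natCast, ← rpow_add hM0]
    congr 1
    push_cast
    ring
  have hp0 : 0 < M ^ (2 + k) := rpow_pos_of_pos hM0 _
  have hdM : d * M ^ 4 ≤ M ^ (2 + k) + δ * M ^ 4 := by
    rw [hd, max_mul_of_nonneg _ _ (by positivity), hp4]
    have : 0 ≤ δ * M ^ 4 := by positivity
    exact max_le (by linarith) (by linarith)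
  have hmono : ((nearSols c L M δ).ncard : ℝ) ≤ (nearSols c L M d).ncard := by
    refine Nat.cast_le.2 (Set.ncard_le_ncard (fun m hm => ⟨hm.1, hm.2.trans ?_⟩)
      (nearSols_finite hL hM0))
    exact mul_le_mul_of_nonneg_right hδd (rpow_nonneg hM0.le _)
  have hδM : 0 ≤ δ * M ^ 4 := by positivity
  have hL4 : 0 < L ^ 4 := by positivity
  refine hmono.trans ?_
  rcases le_or_gt 1 d with h1 | h1
  · refine (ncard_nearSols_le hL hM0).trans ?_
    rw [mul_pow]
    have h2 : M ^ 4 ≤ d * M ^ 4 := le_mul_of_one_le_left (by positivity) h1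
    have h3 : L ^ 4 * M ^ 4 ≤ L ^ 4 * (M ^ (2 + k) + δ * M ^ 4) :=
      mul_le_mul_of_nonneg_left (h2.trans hdM) hL4.le
    have h4 : 0 ≤ C * (M ^ (2 + k) + δ * M ^ 4) := by positivity
    linarith
  · have hs : √d ^ 2 = d := sq_sqrt hd0.le
    have hs0 : 0 < √d := sqrt_pos.2 hd0
    have hsM : 1 ≤ √d * M := by
      have h2 : 1 ≤ (√d * M) ^ 2 := by
        rw [mul_pow, hs]
        refine le_trans ?_ (mul_le_mul_of_nonneg_right hMd (sq_nonneg M))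
        rw [← rpow_two, ← rpow_add hM0]
        exact one_le_rpow hM (by linarith)
      exact (one_le_sq_iff₀ (by positivity)).1 h2
    have key := h M √d hM hs0 (sqrt_le_one.2 h1.le) hsM
    rw [hs] at key
    refine key.trans ?_
    have h5 : M ^ 2 * (1 / (d * M)) ^ κ ≤ M ^ (2 + k) := by
      have h6 : 1 / (d * M) ≤ M ^ (1 - k) := by
        rw [div_le_iff₀ (by positivity)]
        calc (1 : ℝ) = M ^ (1 - k) * (M ^ (k - 2) * M) := by
              rw [← rpow_add_one hM0.ne', ← rpow_add hM0]
              rw [show 1 - k + (k - 2 + 1) = 0 by ring, rpow_zero]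
          _ ≤ _ := by gcongr
      calc M ^ 2 * (1 / (d * M)) ^ κ ≤ M ^ 2 * (M ^ (1 - k)) ^ κ := by gcongr
        _ = M ^ (2 + k) := by
            rw [← rpow_mul hM0.le, hk1, ← rpow_two, ← rpow_add hM0]
    have h7 : C * (d * M ^ 4 + M ^ 2 * (1 / (d * M)) ^ κ) ≤
        C * (2 * (M ^ (2 + k) + δ * M ^ 4)) := mul_le_mul_of_nonneg_left (by linarith) hC.le
    have h8 : 0 ≤ L ^ 4 * (M ^ (2 + k) + δ * M ^ 4) := by positivity
    linarith

theorem energyBound_two_div (n : ℕ) :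
    ∀ c : ℝ, c ≠ 0 → c ≠ 1 → EnergyBound c (2 / (2 * n + 1)) := by
  induction n with
  | zero =>
    intro c _ _
    simpa using energyBound_two c
  | succ n ih =>
    intro c hc0 hc1
    have hc : c - 1 ≠ 0 := sub_ne_zero.2 hc1
    have hcc : (c - 1) * (c / (c - 1) - 1) = 1 := by field_simp; ring
    have hE := ih (c / (c - 1)) (div_ne_zero hc0 hc) (fun h => by simp [h] at hcc)
    have hκ : (0 : ℝ) < 2 / (2 * n + 1) := by positivity
    have e : (2 : ℝ) / (2 * n + 1) / (1 + 2 / (2 * n + 1)) = 2 / (2 * (n + 1 : ℕ) + 1) := by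
      push_cast
      field_simp
      ring
    exact e ▸ hE.of_dual hc0 hcc hκ

theorem stmt_3 (c : ℝ) (hc : 0 < c) (hci : ∀ m : ℤ, c ≠ (m : ℝ)) (ε : ℝ) (hε : 0 < ε) :
    ∃ C : ℝ, 0 < C ∧ ∀ M : ℝ, 2 ≤ M → ∀ δ : ℝ, 0 < δ →
      (Nat.card {m : Fin 4 → ℤ // (∀ j, M < (m j : ℝ) ∧ (m j : ℝ) ≤ 2 * M) ∧
          |(m 0 : ℝ) ^ c + (m 1 : ℝ) ^ c - (m 2 : ℝ) ^ c - (m 3 : ℝ) ^ c| ≤ δ * M ^ c} : ℝ) ≤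
        C * M ^ ε * (M ^ 2 + δ * M ^ 4) := by
  obtain ⟨n, hn⟩ := exists_nat_gt (1 / ε)
  have hκ : 2 / (2 * (n : ℝ) + 1) ≤ ε := by
    rw [div_lt_iff₀ hε] at hn
    rw [div_le_iff₀ (by positivity)]
    linarith
  obtain ⟨C, hC, h⟩ := energyBound_two_div n c hc.ne' (by simpa using hci 1) 2 one_le_two
  refine ⟨C, hC, fun M hM δ hδ => ?_⟩
  have hM0 : 0 < M := by linarith
  have hM1 : 1 ≤ M := by linarith
  have hcard : (Nat.card {m : Fin 4 → ℤ // (∀ j, M < (m j : ℝ) ∧ (m j : ℝ) ≤ 2 * M) ∧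
      |(m 0 : ℝ) ^ c + (m 1 : ℝ) ^ c - (m 2 : ℝ) ^ c - (m 3 : ℝ) ^ c| ≤ δ * M ^ c}) ≤
      (nearSols c 2 M δ).ncard := by
    refine Set.ncard_le_ncard (s := {m : Fin 4 → ℤ | (∀ j, M < (m j : ℝ) ∧ (m j : ℝ) ≤ 2 * M) ∧
      |(m 0 : ℝ) ^ c + (m 1 : ℝ) ^ c - (m 2 : ℝ) ^ c - (m 3 : ℝ) ^ c| ≤ δ * M ^ c})
      (fun m hm => ⟨fun j => ⟨?_, (hm.1 j).2⟩, hm.2⟩) (nearSols_finite one_le_two hM0)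
    have := (hm.1 j).1
    linarith
  refine (Nat.cast_le.2 hcard).trans ((h M hM1 δ hδ).trans ?_)
  rw [mul_assoc]
  refine mul_le_mul_of_nonneg_left ?_ hC.le
  rw [mul_add]
  refine add_le_add ?_ (le_mul_of_one_le_left (by positivity) (one_le_rpow hM1 hε.le))
  rw [← rpow_two, ← rpow_add hM0]
  exact rpow_le_rpow_of_exponent_le hM1 (by linarith)
end

section
/- Let ℓ ∈ {1,2,3} and ε > 0. There is a constant C > 0 such that for every real T ≥ 10 and every real y with 1 ≤ y ≤ T^{1/2}, one has ∫_T^{2T} |R₁(x;y)|^{2ℓ} dx ≤ C · T^{1 + 9ℓ/4 + ε}. -/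
open Real Finset

/-- `R₁(x; y) = (x^{9/8}/(4π²)) ∑_{n ≤ y} (c_n/n^{7/8}) cos(8π(nx)^{1/4} − π/4)`. -/
noncomputable def R1 (c : ℕ → ℝ) (x y : ℝ) : ℝ :=
  x ^ ((9 : ℝ) / 8) / (4 * π ^ 2) *
    ∑ n ∈ Finset.Icc 1 ⌊y⌋₊,
      c n / (n : ℝ) ^ ((7 : ℝ) / 8) * Real.cos (8 * π * ((n : ℝ) * x) ^ ((1 : ℝ) / 4) - π / 4)

/-- First derivative test for the phase `x ^ (1/4)`. -/
lemma abs_integral_cos_rpow_le {T α : ℝ} (hT : 0 < T) (hα : α ≠ 0) (β : ℝ) :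
    |∫ x in T..(2 * T), cos (α * x ^ ((1 : ℝ) / 4) + β)| ≤ 15 * T ^ ((3 : ℝ) / 4) / |α| := by
  have hpos : ∀ x ∈ Set.uIcc T (2 * T), 0 < x := fun x hx => by
    rw [Set.uIcc_of_le (by linarith)] at hx
    linarith [hx.1]
  have hcont : ∀ p : ℝ, ContinuousOn (fun x : ℝ => x ^ p) (Set.uIcc T (2 * T)) := fun p x hx =>
    (continuousAt_rpow_const x p (Or.inl (hpos x hx).ne')).continuousWithinAt
  have hcos : IntervalIntegrable (fun x => cos (α * x ^ ((1 : ℝ) / 4) + β))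
      MeasureTheory.volume T (2 * T) := by
    apply ContinuousOn.intervalIntegrable
    have := hcont (1 / 4)
    fun_prop
  have hsin : IntervalIntegrable
      (fun x => 3 / α * x ^ (-(1 : ℝ) / 4) * sin (α * x ^ ((1 : ℝ) / 4) + β))
      MeasureTheory.volume T (2 * T) := by
    apply ContinuousOn.intervalIntegrable
    have := hcont (1 / 4)
    have := hcont (-1 / 4)
    fun_prop
  have hderiv : ∀ x ∈ Set.uIcc T (2 * T),
      HasDerivAt (fun x : ℝ => 4 / α * x ^ ((3 : ℝ) / 4) * sin (α * x ^ ((1 : ℝ) / 4) + β))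
        (3 / α * x ^ (-(1 : ℝ) / 4) * sin (α * x ^ ((1 : ℝ) / 4) + β)
          + cos (α * x ^ ((1 : ℝ) / 4) + β)) x := by
    intro x hx
    have hx0 := hpos x hx
    have h1 := (hasDerivAt_rpow_const (x := x) (p := 3 / 4) (Or.inl hx0.ne')).const_mul (4 / α)
    have h2 := (((hasDerivAt_rpow_const (x := x) (p := 1 / 4)
      (Or.inl hx0.ne')).const_mul α).add_const β).sin
    refine (h1.mul h2).congr_deriv ?_
    have e1 : x ^ ((3 : ℝ) / 4 - 1) = x ^ (-(1 : ℝ) / 4) := by norm_num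
    have e2 : x ^ ((3 : ℝ) / 4) * x ^ ((1 : ℝ) / 4 - 1) = 1 := by
      rw [← rpow_add hx0]; norm_num
    rw [e1]
    linear_combination cos (α * x ^ ((1 : ℝ) / 4) + β) * e2 +
      cos (α * x ^ ((1 : ℝ) / 4) + β) * (x ^ ((3 : ℝ) / 4) * x ^ ((1 : ℝ) / 4 - 1)) *
        mul_inv_cancel₀ hα
  have hFTC := intervalIntegral.integral_eq_sub_of_hasDerivAt hderiv (hsin.add hcos)
  rw [intervalIntegral.integral_add hsin hcos] at hFTC
  have hα' : 0 < |α| := abs_pos.2 hα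
  have hP : 0 < T ^ ((3 : ℝ) / 4) := by positivity
  have hbound : |∫ x in T..(2 * T), 3 / α * x ^ (-(1 : ℝ) / 4) *
      sin (α * x ^ ((1 : ℝ) / 4) + β)| ≤ 3 / |α| * T ^ ((3 : ℝ) / 4) := by
    have := intervalIntegral.norm_integral_le_of_norm_le_const (a := T) (b := 2 * T)
      (C := 3 / |α| * T ^ (-(1 : ℝ) / 4))
      (f := fun x => 3 / α * x ^ (-(1 : ℝ) / 4) * sin (α * x ^ ((1 : ℝ) / 4) + β)) (by
        intro x hx
        rw [Set.uIoc_of_le (by linarith)] at hx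
        have hx0 : 0 < x := hT.trans hx.1
        rw [norm_eq_abs, abs_mul, abs_mul, abs_div, abs_of_pos (rpow_pos_of_pos hx0 _)]
        have hle : x ^ (-(1 : ℝ) / 4) ≤ T ^ (-(1 : ℝ) / 4) :=
          rpow_le_rpow_of_nonpos hT hx.1.le (by norm_num)
        calc |3| / |α| * x ^ (-(1 : ℝ) / 4) * |sin (α * x ^ ((1 : ℝ) / 4) + β)|
            ≤ |3| / |α| * x ^ (-(1 : ℝ) / 4) * 1 := by
              gcongr
              exact abs_sin_le_one _
          _ ≤ 3 / |α| * T ^ (-(1 : ℝ) / 4) := by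
              rw [mul_one, abs_of_pos (by norm_num : (0 : ℝ) < 3)]
              gcongr)
    rw [norm_eq_abs] at this
    refine this.trans_eq ?_
    have e : |2 * T - T| = T := by rw [abs_of_pos] <;> linarith
    have e2 : T ^ ((3 : ℝ) / 4) = T ^ (-(1 : ℝ) / 4) * T := by
      rw [← rpow_add_one hT.ne']; norm_num
    rw [e, e2, mul_assoc]
  have hend : ∀ x θ : ℝ, 0 < x → |4 / α * x ^ ((3 : ℝ) / 4) * sin θ|
      ≤ 4 / |α| * x ^ ((3 : ℝ) / 4) := by
    intro x θ hx
    rw [abs_mul, abs_mul, abs_div, abs_of_pos (rpow_pos_of_pos hx _),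
      abs_of_pos (by norm_num : (0 : ℝ) < 4)]
    exact mul_le_of_le_one_right (by positivity) (abs_sin_le_one _)
  have h2 : (2 * T) ^ ((3 : ℝ) / 4) ≤ 2 * T ^ ((3 : ℝ) / 4) := by
    rw [mul_rpow (by norm_num) hT.le]
    gcongr
    exact (rpow_le_rpow_of_exponent_le (by norm_num) (by norm_num : (3 : ℝ) / 4 ≤ 1)).trans_eq
      (rpow_one 2)
  have hA := hend (2 * T) (α * (2 * T) ^ ((1 : ℝ) / 4) + β) (by positivity)
  have hB := hend T (α * T ^ ((1 : ℝ) / 4) + β) hT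
  have hA2 : 4 / |α| * (2 * T) ^ ((3 : ℝ) / 4) ≤ 4 / |α| * (2 * T ^ ((3 : ℝ) / 4)) := by gcongr
  rw [abs_le] at hbound hA hB ⊢
  have e : 15 * T ^ ((3 : ℝ) / 4) / |α| = 4 / |α| * (2 * T ^ ((3 : ℝ) / 4))
      + 4 / |α| * T ^ ((3 : ℝ) / 4) + 3 / |α| * T ^ ((3 : ℝ) / 4) := by ring
  rw [e]
  constructor <;> linarith [hbound.1, hbound.2, hA.1, hA.2, hB.1, hB.2]

lemma abs_sub_le_mul_abs_rpow_sub {M n m : ℝ} (hM : 0 < M) (hn : M ≤ n) (hn' : n ≤ 2 * M)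
    (hm : M ≤ m) (hm' : m ≤ 2 * M) :
    |n - m| ≤ 8 * M ^ ((3 : ℝ) / 4) * |n ^ ((1 : ℝ) / 4) - m ^ ((1 : ℝ) / 4)| := by
  have key : ∀ z : ℝ, M ≤ z → z ≤ 2 * M → 0 ≤ z ^ ((1 : ℝ) / 4) ∧
      z ^ ((1 : ℝ) / 4) ≤ (2 * M) ^ ((1 : ℝ) / 4) ∧ (z ^ ((1 : ℝ) / 4)) ^ 4 = z := by
    intro z h1 h2
    have h0 : 0 ≤ z := by linarith
    refine ⟨by positivity, by gcongr, ?_⟩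
    rw [← rpow_natCast, ← rpow_mul h0]
    norm_num
  obtain ⟨ha0, ha, ha4⟩ := key n hn hn'
  obtain ⟨hb0, hb, hb4⟩ := key m hm hm'
  set a := n ^ ((1 : ℝ) / 4)
  set b := m ^ ((1 : ℝ) / 4)
  set w := (2 * M) ^ ((1 : ℝ) / 4) with hw
  have hw3 : w ^ 3 ≤ 2 * M ^ ((3 : ℝ) / 4) := by
    rw [hw, ← rpow_natCast, ← rpow_mul (by positivity), mul_rpow (by norm_num) hM.le]
    norm_num
    gcongr
    exact (rpow_le_rpow_of_exponent_le (by norm_num) (by norm_num : (3 : ℝ) / 4 ≤ 1)).trans_eq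
      (rpow_one 2)
  have hfac : n - m = ((a + b) * (a ^ 2 + b ^ 2)) * (a - b) := by
    rw [← ha4, ← hb4]; ring
  rw [hfac, abs_mul, abs_of_nonneg (by positivity)]
  refine mul_le_mul_of_nonneg_right ?_ (abs_nonneg _)
  calc (a + b) * (a ^ 2 + b ^ 2) ≤ (w + w) * (w ^ 2 + w ^ 2) := by gcongr
    _ = 4 * w ^ 3 := by ring
    _ ≤ 8 * M ^ ((3 : ℝ) / 4) := by linarith

lemma sum_range_inv_le {k M : ℕ} (h : k ≤ M) :
    ∑ j ∈ range k, (1 : ℝ) / (j + 1) ≤ 1 + log M := by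
  calc ∑ j ∈ range k, (1 : ℝ) / (j + 1) ≤ ∑ j ∈ range M, (1 : ℝ) / (j + 1) :=
        sum_le_sum_of_subset_of_nonneg (range_subset_range.2 h) fun _ _ _ => by positivity
    _ = harmonic M := by
        simp [harmonic]
    _ ≤ _ := harmonic_le_one_add_log M

lemma sum_inv_abs_sub_le {M n : ℕ} {S : Finset ℕ} (hS : S ⊆ Ico M (2 * M)) (hn : n ∈ S) :
    ∑ m ∈ S.erase n, 1 / |(n : ℝ) - m| ≤ 2 * (1 + log M) := by
  have hnI := mem_Ico.1 (hS hn)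
  have hlow : ∑ m ∈ Ico M n, 1 / |(n : ℝ) - m| ≤ 1 + log M := by
    refine le_trans (le_of_eq ?_) (sum_range_inv_le (show n - M ≤ M by omega))
    rw [sum_Ico_eq_sum_range, ← sum_range_reflect]
    refine sum_congr rfl fun j hj => ?_
    have hj := mem_range.1 hj
    have e : ((M + (n - M - 1 - j) : ℕ) : ℝ) = n - (j + 1) := by
      rw [eq_sub_iff_add_eq]
      exact_mod_cast (show M + (n - M - 1 - j) + (j + 1) = n by omega)
    rw [e, sub_sub_cancel, abs_of_pos (by positivity)]
  have hhigh : ∑ m ∈ Ico (n + 1) (2 * M), 1 / |(n : ℝ) - m| ≤ 1 + log M := by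
    refine le_trans (le_of_eq ?_) (sum_range_inv_le (show 2 * M - (n + 1) ≤ M by omega))
    rw [sum_Ico_eq_sum_range]
    refine sum_congr rfl fun j _ => ?_
    have e : (n : ℝ) - ((n + 1 + j : ℕ) : ℝ) = -(j + 1) := by push_cast; ring
    rw [e, abs_neg, abs_of_pos (by positivity)]
  have hsub : S.erase n ⊆ Ico M n ∪ Ico (n + 1) (2 * M) := by
    intro m hm
    have h1 := mem_Ico.1 (hS (mem_of_mem_erase hm))
    have h2 := ne_of_mem_erase hm
    rw [mem_union, mem_Ico, mem_Ico]
    omega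
  have hdisj : Disjoint (Ico M n) (Ico (n + 1) (2 * M)) := by
    rw [disjoint_left]
    intro m h1 h2
    rw [mem_Ico] at h1 h2
    omega
  calc _ ≤ ∑ m ∈ Ico M n ∪ Ico (n + 1) (2 * M), 1 / |(n : ℝ) - m| :=
        sum_le_sum_of_subset_of_nonneg hsub fun _ _ _ => by positivity
    _ ≤ _ := by rw [sum_union hdisj]; linarith

/-- The oscillating factor of the `n`-th term of `R1`. -/
noncomputable def wave (n : ℕ) (x : ℝ) : ℝ :=
  cos (8 * π * ((n : ℝ) * x) ^ ((1 : ℝ) / 4) - π / 4)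

lemma continuous_wave (n : ℕ) : Continuous (wave n) := by
  have : Continuous fun x : ℝ => ((n : ℝ) * x) ^ ((1 : ℝ) / 4) :=
    (continuous_const.mul continuous_id).rpow_const fun _ => Or.inr (by norm_num)
  unfold wave
  fun_prop

lemma abs_wave_le_one (n : ℕ) (x : ℝ) : |wave n x| ≤ 1 := abs_cos_le_one _

lemma abs_integral_wave_mul_wave_le {T : ℝ} (hT : 0 < T) (n m : ℕ) :
    |∫ x in T..(2 * T), wave n x * wave m x| ≤ T := by
  have := intervalIntegral.norm_integral_le_of_norm_le_const (a := T) (b := 2 * T) (C := 1)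
      (f := fun x => wave n x * wave m x) (by
        intro x _
        rw [norm_eq_abs, abs_mul]
        exact mul_le_one₀ (abs_wave_le_one n x) (abs_nonneg _) (abs_wave_le_one m x))
  rw [norm_eq_abs, one_mul] at this
  refine this.trans_eq ?_
  rw [abs_of_pos] <;> linarith

lemma abs_integral_wave_mul_wave_le_of_ne {T : ℝ} (hT : 0 < T) {M n m : ℕ}
    (hn : n ∈ Ico M (2 * M)) (hm : m ∈ Ico M (2 * M)) (hnm : n ≠ m) :
    |∫ x in T..(2 * T), wave n x * wave m x| ≤
      5 * (T ^ ((3 : ℝ) / 4) * (M : ℝ) ^ ((3 : ℝ) / 4)) * (1 / |(n : ℝ) - m|) := by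
  rw [mem_Ico] at hn hm
  have hM : (0 : ℝ) < M := by
    have : 0 < M := by omega
    exact_mod_cast this
  have hdiff := abs_sub_le_mul_abs_rpow_sub (M := M) (n := n) (m := m) hM
    (by exact_mod_cast hn.1) (by exact_mod_cast hn.2.le) (by exact_mod_cast hm.1)
    (by exact_mod_cast hm.2.le)
  set a := (n : ℝ) ^ ((1 : ℝ) / 4) with ha
  set b := (m : ℝ) ^ ((1 : ℝ) / 4) with hb
  have ha0 : 0 ≤ a := by positivity
  have hb0 : 0 ≤ b := by positivity
  have hnm0 : 0 < |(n : ℝ) - m| := abs_pos.2 (sub_ne_zero.2 (by exact_mod_cast hnm))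
  have hab : 0 < |a - b| := by
    by_contra! h
    have : |a - b| = 0 := le_antisymm h (abs_nonneg _)
    rw [this, mul_zero] at hdiff
    linarith
  have hsum : |a - b| ≤ |a + b| := by
    rw [abs_of_nonneg (by positivity : 0 ≤ a + b), abs_le]
    constructor <;> linarith
  have hpi := pi_gt_three
  have hbd : ∀ d β : ℝ, |a - b| ≤ |d| →
      |∫ x in T..(2 * T), cos (8 * π * d * x ^ ((1 : ℝ) / 4) + β)| ≤
        5 * (T ^ ((3 : ℝ) / 4) * (M : ℝ) ^ ((3 : ℝ) / 4)) * (1 / |(n : ℝ) - m|) := by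
    intro d β hd
    have hd0 : 0 < |d| := hab.trans_le hd
    refine (abs_integral_cos_rpow_le hT (α := 8 * π * d)
      (mul_ne_zero (by positivity) (abs_pos.1 hd0)) β).trans ?_
    rw [abs_mul, abs_of_pos (by positivity : 0 < 8 * π), mul_one_div,
      div_le_div_iff₀ (by positivity) hnm0]
    have h1 : |(n : ℝ) - m| ≤ 8 * (M : ℝ) ^ ((3 : ℝ) / 4) * |d| :=
      hdiff.trans (by gcongr)
    calc 15 * T ^ ((3 : ℝ) / 4) * |(n : ℝ) - m|
        ≤ 15 * T ^ ((3 : ℝ) / 4) * (8 * (M : ℝ) ^ ((3 : ℝ) / 4) * |d|) := by gcongr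
      _ = 5 * (T ^ ((3 : ℝ) / 4) * (M : ℝ) ^ ((3 : ℝ) / 4)) * (8 * 3 * |d|) := by ring
      _ ≤ _ := by gcongr
  have hcont : ∀ d β : ℝ, IntervalIntegrable
      (fun x => cos (8 * π * d * x ^ ((1 : ℝ) / 4) + β)) MeasureTheory.volume T (2 * T) := by
    intro d β
    apply Continuous.intervalIntegrable
    have : Continuous fun x : ℝ => x ^ ((1 : ℝ) / 4) :=
      continuous_id.rpow_const fun _ => Or.inr (by norm_num)
    fun_prop
  have heq : ∫ x in T..(2 * T), wave n x * wave m x = ∫ x in T..(2 * T),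
      ((1 / 2) * cos (8 * π * (a - b) * x ^ ((1 : ℝ) / 4) + 0)
        + (1 / 2) * cos (8 * π * (a + b) * x ^ ((1 : ℝ) / 4) + -(π / 2))) := by
    apply intervalIntegral.integral_congr
    intro x hx
    rw [Set.uIcc_of_le (by linarith)] at hx
    have hx0 : 0 ≤ x := by linarith [hx.1]
    simp only [wave]
    rw [mul_rpow (by positivity) hx0, mul_rpow (by positivity) hx0, ← ha, ← hb]
    set r := x ^ ((1 : ℝ) / 4)
    have e1 : 8 * π * (a - b) * r + 0
        = (8 * π * (a * r) - π / 4) - (8 * π * (b * r) - π / 4) := by ring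
    have e2 : 8 * π * (a + b) * r + -(π / 2)
        = (8 * π * (a * r) - π / 4) + (8 * π * (b * r) - π / 4) := by ring
    rw [e1, e2]
    generalize 8 * π * (a * r) - π / 4 = u
    generalize 8 * π * (b * r) - π / 4 = v
    rw [cos_sub, cos_add]
    ring
  rw [heq, intervalIntegral.integral_add ((hcont _ _).const_mul _) ((hcont _ _).const_mul _),
    intervalIntegral.integral_const_mul, intervalIntegral.integral_const_mul]
  have h1 := abs_le.1 (hbd (a - b) 0 le_rfl)
  have h2 := abs_le.1 (hbd (a + b) (-(π / 2)) hsum)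
  rw [abs_le]
  constructor <;> linarith [h1.1, h1.2, h2.1, h2.2]

/-- Mean square over `[T, 2T]` of a sum of waves with frequencies in a dyadic block. -/
lemma integral_sum_wave_sq_le {T A : ℝ} (hT : 0 < T) {M : ℕ} {S : Finset ℕ}
    (hS : S ⊆ Ico M (2 * M)) {a : ℕ → ℝ} (ha : ∀ n ∈ S, |a n| ≤ A) :
    ∫ x in T..(2 * T), (∑ n ∈ S, a n * wave n x) ^ 2 ≤
      A ^ 2 * (M * (T + 10 * (T ^ ((3 : ℝ) / 4) * (M : ℝ) ^ ((3 : ℝ) / 4)) * (1 + log M))) := by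
  set P := T ^ ((3 : ℝ) / 4) * (M : ℝ) ^ ((3 : ℝ) / 4) with hP
  have hP0 : 0 ≤ P := by positivity
  have hexp : ∫ x in T..(2 * T), (∑ n ∈ S, a n * wave n x) ^ 2
      = ∑ n ∈ S, ∑ m ∈ S, a n * a m * ∫ x in T..(2 * T), wave n x * wave m x := by
    have : (fun x => (∑ n ∈ S, a n * wave n x) ^ 2)
        = fun x => ∑ n ∈ S, ∑ m ∈ S, a n * a m * (wave n x * wave m x) := by
      funext x
      rw [sq, sum_mul_sum]
      exact sum_congr rfl fun _ _ => sum_congr rfl fun _ _ => by ring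
    rw [this]
    have hc : ∀ n m, Continuous fun x => a n * a m * (wave n x * wave m x) := fun n m =>
      continuous_const.mul ((continuous_wave n).mul (continuous_wave m))
    rw [intervalIntegral.integral_finsetSum fun n _ =>
      (continuous_finsetSum _ fun m _ => hc n m).intervalIntegrable _ _]
    refine sum_congr rfl fun n _ => ?_
    rw [intervalIntegral.integral_finsetSum fun m _ => (hc n m).intervalIntegrable _ _]
    exact sum_congr rfl fun m _ => intervalIntegral.integral_const_mul _ _
  have hterm : ∀ n ∈ S, ∀ m ∈ S, ∀ B, |∫ x in T..(2 * T), wave n x * wave m x| ≤ B →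
      a n * a m * ∫ x in T..(2 * T), wave n x * wave m x ≤ A ^ 2 * B := by
    intro n hn m hm B hB
    refine (le_abs_self _).trans ?_
    rw [abs_mul, abs_mul, sq]
    have := (abs_nonneg _).trans (ha n hn)
    gcongr
    exacts [ha n hn, ha m hm]
  have hrow : ∀ n ∈ S, ∑ m ∈ S, a n * a m * ∫ x in T..(2 * T), wave n x * wave m x ≤
      A ^ 2 * (T + 10 * P * (1 + log M)) := by
    intro n hn
    rw [← add_sum_erase S _ hn, mul_add]
    refine add_le_add (hterm n hn n hn _ (abs_integral_wave_mul_wave_le hT n n)) ?_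
    calc _ ≤ ∑ m ∈ S.erase n, A ^ 2 * (5 * P * (1 / |(n : ℝ) - m|)) :=
          sum_le_sum fun m hm => hterm n hn m (mem_of_mem_erase hm) _
            (abs_integral_wave_mul_wave_le_of_ne hT (hS hn) (hS (mem_of_mem_erase hm))
              (ne_of_mem_erase hm).symm)
      _ = A ^ 2 * (5 * P * ∑ m ∈ S.erase n, 1 / |(n : ℝ) - m|) := by
          rw [mul_sum, mul_sum]
      _ ≤ A ^ 2 * (5 * P * (2 * (1 + log M))) := by
          gcongr
          exact sum_inv_abs_sub_le hS hn
      _ = _ := by ring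
  have hlog : 0 ≤ log (M : ℝ) := log_natCast_nonneg M
  rw [hexp]
  refine (sum_le_card_nsmul S _ _ hrow).trans ?_
  have hcard : (S.card : ℝ) ≤ M := by
    have := card_le_card hS
    rw [Nat.card_Ico] at this
    exact_mod_cast (show S.card ≤ M by omega)
  rw [nsmul_eq_mul, mul_left_comm]
  gcongr

lemma continuous_sum_wave (S : Finset ℕ) (a : ℕ → ℝ) :
    Continuous fun x => ∑ n ∈ S, a n * wave n x :=
  continuous_finsetSum _ fun n _ => continuous_const.mul (continuous_wave n)

/-- Moments of orders 2, 4, 6 of a dyadic block, from its mean square and its trivial bound. -/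
lemma integral_abs_sum_wave_pow_le {T B : ℝ} (hT : 1 ≤ T) (hB : 0 ≤ B) {M : ℕ} (hM : 1 ≤ M)
    (hMT : (M : ℝ) ≤ T ^ ((1 : ℝ) / 2)) {S : Finset ℕ} (hS : S ⊆ Ico M (2 * M)) {a : ℕ → ℝ}
    (ha : ∀ n ∈ S, |a n| ≤ B * (M : ℝ) ^ (-(7 : ℝ) / 8)) {k : ℕ} (hk : k ≤ 2) :
    ∫ x in T..(2 * T), |∑ n ∈ S, a n * wave n x| ^ (2 * (k + 1)) ≤
      B ^ (2 * (k + 1)) * (11 * T * (1 + log M)) := by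
  have hT0 : 0 < T := by linarith
  have hM1 : (1 : ℝ) ≤ M := by exact_mod_cast hM
  have hM0 : (0 : ℝ) < M := by linarith
  have hL : 0 ≤ log (M : ℝ) := log_natCast_nonneg M
  set A := B * (M : ℝ) ^ (-(7 : ℝ) / 8) with hA
  have hA0 : 0 ≤ A := by positivity
  have hsup : ∀ x, |∑ n ∈ S, a n * wave n x| ≤ M * A := by
    intro x
    have hcard : (S.card : ℝ) ≤ M := by
      have := card_le_card hS
      rw [Nat.card_Ico] at this
      exact_mod_cast (show S.card ≤ M by omega)
    calc |∑ n ∈ S, a n * wave n x| ≤ ∑ n ∈ S, |a n * wave n x| := abs_sum_le_sum_abs _ _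
      _ ≤ S.card • A := by
        refine sum_le_card_nsmul S _ _ fun n hn => ?_
        rw [abs_mul]
        exact (mul_le_of_le_one_right (abs_nonneg _) (abs_wave_le_one n x)).trans (ha n hn)
      _ ≤ M * A := by
        rw [nsmul_eq_mul]
        gcongr
  have hcont := continuous_sum_wave S a
  have hstep : ∫ x in T..(2 * T), |∑ n ∈ S, a n * wave n x| ^ (2 * (k + 1)) ≤
      (M * A) ^ (2 * k) * ∫ x in T..(2 * T), (∑ n ∈ S, a n * wave n x) ^ 2 := by
    rw [← intervalIntegral.integral_const_mul]
    refine intervalIntegral.integral_mono_on (by linarith)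
      ((hcont.abs.pow _).intervalIntegrable _ _)
      ((continuous_const.mul (hcont.pow 2)).intervalIntegrable _ _) fun x _ => ?_
    rw [mul_add, mul_one, pow_add, sq_abs]
    gcongr
    exact hsup x
  refine hstep.trans ((mul_le_mul_of_nonneg_left (integral_sum_wave_sq_le hT0 hS ha)
    (by positivity)).trans ?_)
  have hMA : M * A = B * (M : ℝ) ^ ((1 : ℝ) / 8) := by
    rw [hA, mul_left_comm, ← rpow_one_add' hM0.le (by norm_num)]
    norm_num
  have hpow : ((M : ℝ) ^ ((1 : ℝ) / 8)) ^ (2 * k) ≤ (M : ℝ) ^ ((1 : ℝ) / 2) := by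
    rw [← rpow_natCast, ← rpow_mul hM0.le]
    refine rpow_le_rpow_of_exponent_le hM1 ?_
    have : (k : ℝ) ≤ 2 := by exact_mod_cast hk
    push_cast
    linarith
  have hMhalf : (M : ℝ) ^ ((1 : ℝ) / 2) ≤ T ^ ((1 : ℝ) / 4) := by
    calc (M : ℝ) ^ ((1 : ℝ) / 2) ≤ (T ^ ((1 : ℝ) / 2)) ^ ((1 : ℝ) / 2) := by gcongr
      _ = T ^ ((1 : ℝ) / 4) := by rw [← rpow_mul hT0.le]; norm_num
  have hAM : A ^ 2 * M = B ^ 2 * (M : ℝ) ^ (-(3 : ℝ) / 4) := by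
    rw [hA, mul_pow, mul_assoc, ← rpow_natCast, ← rpow_natCast ((M : ℝ) ^ _),
      ← rpow_mul hM0.le, ← rpow_add_one hM0.ne']
    norm_num
  have e1 : (M : ℝ) ^ ((1 : ℝ) / 2) * (M : ℝ) ^ (-(3 : ℝ) / 4) ≤ 1 := by
    rw [← rpow_add hM0]
    exact rpow_le_one_of_one_le_of_nonpos hM1 (by norm_num)
  have e2 : (M : ℝ) ^ (-(3 : ℝ) / 4) * (M : ℝ) ^ ((3 : ℝ) / 4) = 1 := by
    rw [← rpow_add hM0]; norm_num
  have e3 : T ^ ((1 : ℝ) / 4) * T ^ ((3 : ℝ) / 4) = T := by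
    rw [← rpow_add hT0]; norm_num
  calc (M * A) ^ (2 * k) *
        (A ^ 2 * (M * (T + 10 * (T ^ ((3 : ℝ) / 4) * (M : ℝ) ^ ((3 : ℝ) / 4)) * (1 + log M))))
      = B ^ (2 * (k + 1)) * (((M : ℝ) ^ ((1 : ℝ) / 8)) ^ (2 * k) * ((M : ℝ) ^ (-(3 : ℝ) / 4) *
        (T + 10 * (T ^ ((3 : ℝ) / 4) * (M : ℝ) ^ ((3 : ℝ) / 4)) * (1 + log M)))) := by
        rw [← mul_assoc (A ^ 2), hAM, hMA]
        ring
    _ ≤ B ^ (2 * (k + 1)) * ((M : ℝ) ^ ((1 : ℝ) / 2) * ((M : ℝ) ^ (-(3 : ℝ) / 4) *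
        (T + 10 * (T ^ ((3 : ℝ) / 4) * (M : ℝ) ^ ((3 : ℝ) / 4)) * (1 + log M)))) := by
        gcongr
    _ = B ^ (2 * (k + 1)) * ((M : ℝ) ^ ((1 : ℝ) / 2) * (M : ℝ) ^ (-(3 : ℝ) / 4) * T +
        10 * ((M : ℝ) ^ ((1 : ℝ) / 2) * T ^ ((3 : ℝ) / 4)) * (1 + log M) *
          ((M : ℝ) ^ (-(3 : ℝ) / 4) * (M : ℝ) ^ ((3 : ℝ) / 4))) := by ring
    _ ≤ B ^ (2 * (k + 1)) * (1 * T +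
        10 * (T ^ ((1 : ℝ) / 4) * T ^ ((3 : ℝ) / 4)) * (1 + log M) * 1) := by
        rw [e2]
        gcongr
    _ ≤ B ^ (2 * (k + 1)) * (11 * T * (1 + log M)) := by
        rw [e3]
        gcongr
        nlinarith [mul_nonneg hT0.le hL]

/-- Moments of orders 2, 4, 6 of the full sum, by splitting it into dyadic blocks. -/
lemma integral_abs_sum_Icc_wave_pow_le {T B : ℝ} (hT : 1 ≤ T) (hB : 0 ≤ B) {N : ℕ}
    (hNT : (N : ℝ) ≤ T ^ ((1 : ℝ) / 2)) {a : ℕ → ℝ}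
    (ha : ∀ n ∈ Icc 1 N, |a n| ≤ B * (n : ℝ) ^ (-(7 : ℝ) / 8)) {k : ℕ} (hk : k ≤ 2) :
    ∫ x in T..(2 * T), |∑ n ∈ Icc 1 N, a n * wave n x| ^ (2 * (k + 1)) ≤
      ((Nat.log 2 N + 1 : ℕ) : ℝ) ^ (2 * (k + 1)) *
        (B ^ (2 * (k + 1)) * (11 * T * (1 + log T))) := by
  set J := Nat.log 2 N + 1 with hJ
  set S : ℕ → Finset ℕ := fun j => {n ∈ Icc 1 N | Nat.log 2 n = j} with hSdef
  have hsplit : ∀ x, ∑ n ∈ Icc 1 N, a n * wave n x =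
      ∑ j ∈ range J, ∑ n ∈ S j, a n * wave n x := by
    intro x
    refine (sum_fiberwise_of_maps_to (fun n hn => ?_) _).symm
    rw [mem_range, hJ]
    exact Nat.lt_succ_of_le (Nat.log_mono_right (mem_Icc.1 hn).2)
  have hblock : ∀ j ∈ range J,
      ∫ x in T..(2 * T), |∑ n ∈ S j, a n * wave n x| ^ (2 * (k + 1)) ≤
        B ^ (2 * (k + 1)) * (11 * T * (1 + log T)) := by
    intro j _
    have hlogT : 0 ≤ log T := log_nonneg hT
    rcases (S j).eq_empty_or_nonempty with hem | ⟨n₀, hn₀⟩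
    · simp only [hem, sum_empty, abs_zero]
      rw [zero_pow (by omega), intervalIntegral.integral_zero]
      positivity
    have hmem : ∀ n ∈ S j, n ∈ Icc 1 N ∧ 2 ^ j ≤ n ∧ n < 2 * 2 ^ j := by
      intro n hn
      obtain ⟨h1, h2⟩ := mem_filter.1 hn
      have h3 := (Nat.log_eq_iff
        (Or.inr ⟨one_lt_two, by have := (mem_Icc.1 h1).1; omega⟩)).1 h2
      exact ⟨h1, h3.1, by rw [← pow_succ']; exact h3.2⟩
    have hjT : ((2 ^ j : ℕ) : ℝ) ≤ T ^ ((1 : ℝ) / 2) := by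
      refine le_trans ?_ hNT
      exact_mod_cast (hmem n₀ hn₀).2.1.trans (mem_Icc.1 (hmem n₀ hn₀).1).2
    have hjpos : (0 : ℝ) < ((2 ^ j : ℕ) : ℝ) := by positivity
    refine (integral_abs_sum_wave_pow_le hT hB Nat.one_le_two_pow hjT
      (fun n hn => mem_Ico.2 (hmem n hn).2) (fun n hn => ?_) hk).trans ?_
    · refine (ha n (hmem n hn).1).trans (mul_le_mul_of_nonneg_left ?_ hB)
      exact rpow_le_rpow_of_nonpos hjpos (by exact_mod_cast (hmem n hn).2.1) (by norm_num)
    · have : ((2 ^ j : ℕ) : ℝ) ≤ T := hjT.trans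
        ((rpow_le_rpow_of_exponent_le hT (by norm_num)).trans_eq (rpow_one T))
      gcongr
  have hcont : ∀ j, Continuous fun x => |∑ n ∈ S j, a n * wave n x| ^ (2 * (k + 1)) := fun j =>
    (continuous_sum_wave _ _).abs.pow _
  calc ∫ x in T..(2 * T), |∑ n ∈ Icc 1 N, a n * wave n x| ^ (2 * (k + 1))
      ≤ ∫ x in T..(2 * T), (J : ℝ) ^ (2 * k + 1) *
          ∑ j ∈ range J, |∑ n ∈ S j, a n * wave n x| ^ (2 * (k + 1)) := by
        refine intervalIntegral.integral_mono_on (by linarith)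
          (((continuous_sum_wave _ _).abs.pow _).intervalIntegrable _ _)
          ((continuous_const.mul
            (continuous_finsetSum _ fun j _ => hcont j)).intervalIntegrable _ _) fun x _ => ?_
        rw [hsplit x]
        have := pow_sum_le_card_mul_sum_pow (s := range J)
          (f := fun j => |∑ n ∈ S j, a n * wave n x|) (fun _ _ => abs_nonneg _) (2 * k + 1)
        rw [card_range] at this
        refine le_trans ?_ this
        exact pow_le_pow_left₀ (abs_nonneg _) (abs_sum_le_sum_abs _ _) _
    _ = (J : ℝ) ^ (2 * k + 1) *
          ∑ j ∈ range J, ∫ x in T..(2 * T), |∑ n ∈ S j, a n * wave n x| ^ (2 * (k + 1)) := by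
        rw [intervalIntegral.integral_const_mul,
          intervalIntegral.integral_finsetSum fun j _ => (hcont j).intervalIntegrable _ _]
    _ ≤ (J : ℝ) ^ (2 * k + 1) * (J * (B ^ (2 * (k + 1)) * (11 * T * (1 + log T)))) := by
        gcongr
        have := sum_le_card_nsmul _ _ _ hblock
        rwa [card_range, nsmul_eq_mul] at this
    _ = _ := by ring

lemma natLog_two_add_one_le {N : ℕ} {T : ℝ} (hT : 1 ≤ T) (hNT : (N : ℝ) ≤ T) :
    ((Nat.log 2 N + 1 : ℕ) : ℝ) ≤ 2 * (1 + log T) := by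
  have hlogT : 0 ≤ log T := log_nonneg hT
  rcases N.eq_zero_or_pos with rfl | hN
  · simp
    linarith
  have h1 : (Nat.log 2 N : ℝ) ≤ log N / log 2 := by
    simpa [logb] using natLog_le_logb N 2
  have h2 : log (N : ℝ) ≤ log T := log_le_log (by exact_mod_cast hN) hNT
  have h3 : log (N : ℝ) / log 2 ≤ 2 * log T := by
    rw [div_le_iff₀ (log_pos one_lt_two)]
    nlinarith [log_two_gt_d9]
  push_cast
  linarith

theorem stmt_4 (c : ℕ → ℝ) (hc0 : ∀ n, 0 ≤ c n)
    (hc : ∀ ε : ℝ, 0 < ε → ∃ K : ℝ, 0 < K ∧ ∀ n : ℕ, 1 ≤ n → c n ≤ K * (n : ℝ) ^ ε)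
    (ℓ : ℕ) (hℓ : ℓ = 1 ∨ ℓ = 2 ∨ ℓ = 3) (ε : ℝ) (hε : 0 < ε) :
    ∃ C : ℝ, 0 < C ∧ ∀ T y : ℝ, 10 ≤ T → 1 ≤ y → y ≤ T ^ ((1 : ℝ) / 2) →
      (∫ x in T..(2 * T), |R1 c x y| ^ (2 * ℓ)) ≤ C * T ^ (1 + 9 * (ℓ : ℝ) / 4 + ε) := by
  obtain ⟨k, rfl, hk⟩ : ∃ k, ℓ = k + 1 ∧ k ≤ 2 := ⟨ℓ - 1, by omega, by omega⟩
  set p := 2 * (k + 1) with hp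
  set η := ε / (2 * p + 1) with hη
  have hη0 : 0 < η := by positivity
  obtain ⟨K, hK, hcK⟩ := hc η hη0
  set D := 1 + 1 / η with hD
  have hD0 : 0 < D := by positivity
  refine ⟨((2 : ℝ) ^ ((9 : ℝ) / 8)) ^ p * ((2 * D) ^ p * (K ^ p * (11 * D))), by positivity, ?_⟩
  intro T y hT hy hyT
  have hT1 : 1 ≤ T := by linarith
  have hT0 : 0 < T := by linarith
  have hy0 : 0 ≤ y := by linarith
  set N := ⌊y⌋₊ with hN
  have hNy : (N : ℝ) ≤ T ^ ((1 : ℝ) / 2) := (Nat.floor_le hy0).trans hyT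
  have hNT : (N : ℝ) ≤ T :=
    hNy.trans ((rpow_le_rpow_of_exponent_le hT1 (by norm_num)).trans_eq (rpow_one T))
  set a : ℕ → ℝ := fun n => c n / (n : ℝ) ^ ((7 : ℝ) / 8) with ha
  have haB : ∀ n ∈ Icc 1 N, |a n| ≤ K * T ^ η * (n : ℝ) ^ (-(7 : ℝ) / 8) := by
    intro n hn
    obtain ⟨hn1, hnN⟩ := mem_Icc.1 hn
    have hnT : (n : ℝ) ≤ T := le_trans (by exact_mod_cast hnN) hNT
    have hn0 : (0 : ℝ) ≤ n := by positivity
    rw [ha, abs_of_nonneg (div_nonneg (hc0 n) (by positivity)), div_eq_mul_inv,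
      ← rpow_neg hn0, neg_div]
    gcongr
    exact (hcK n hn1).trans (by gcongr)
  have hlogT : 0 ≤ log T := log_nonneg hT1
  have hLD : 1 + log T ≤ D * T ^ η := by
    have h1 : 1 ≤ T ^ η := one_le_rpow hT1 hη0.le
    have h2 := log_le_rpow_div hT0.le hη0
    rw [hD, add_mul, one_mul, one_div_mul_eq_div]
    linarith
  have hJ := natLog_two_add_one_le hT1 hNT
  have hmoment := integral_abs_sum_Icc_wave_pow_le hT1 (by positivity) hNy haB hk
  have hcont := continuous_sum_wave (Icc 1 N) a
  have hR1 : (fun x => |R1 c x y| ^ p) =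
      fun x => |x ^ ((9 : ℝ) / 8) / (4 * π ^ 2) * ∑ n ∈ Icc 1 N, a n * wave n x| ^ p := rfl
  have hR1cont : Continuous fun x => |R1 c x y| ^ p := by
    rw [hR1]
    have : Continuous fun x : ℝ => x ^ ((9 : ℝ) / 8) :=
      continuous_id.rpow_const fun _ => Or.inr (by norm_num)
    exact (((this.div_const _).mul hcont).abs).pow p
  calc ∫ x in T..(2 * T), |R1 c x y| ^ p
      ≤ ∫ x in T..(2 * T), ((2 * T) ^ ((9 : ℝ) / 8)) ^ p *
          |∑ n ∈ Icc 1 N, a n * wave n x| ^ p := by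
        refine intervalIntegral.integral_mono_on (by linarith)
          (hR1cont.intervalIntegrable _ _)
          ((continuous_const.mul (hcont.abs.pow p)).intervalIntegrable _ _) fun x hx => ?_
        rw [congrFun hR1 x, ← mul_pow, abs_mul]
        have hx0 : 0 ≤ x := hT0.le.trans hx.1
        have h4 : 1 ≤ 4 * π ^ 2 := by nlinarith [pi_gt_three]
        gcongr
        rw [abs_of_nonneg (by positivity)]
        exact (div_le_self (by positivity) h4).trans (by gcongr; exact hx.2)
    _ ≤ ((2 * T) ^ ((9 : ℝ) / 8)) ^ p *
          (((Nat.log 2 N + 1 : ℕ) : ℝ) ^ p * ((K * T ^ η) ^ p * (11 * T * (1 + log T)))) := by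
        rw [intervalIntegral.integral_const_mul]
        gcongr
    _ ≤ ((2 * T) ^ ((9 : ℝ) / 8)) ^ p *
          ((2 * (D * T ^ η)) ^ p * ((K * T ^ η) ^ p * (11 * T * (D * T ^ η)))) := by
        gcongr
        exact hJ.trans (by gcongr)
    _ = ((2 : ℝ) ^ ((9 : ℝ) / 8)) ^ p * ((2 * D) ^ p * (K ^ p * (11 * D))) *
          ((T ^ ((9 : ℝ) / 8)) ^ p * ((T ^ η) ^ p * ((T ^ η) ^ p * (T * T ^ η)))) := by
        rw [mul_rpow (by norm_num) hT0.le]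
        simp only [mul_pow]
        ring
    _ = _ := by
        congr 1
        simp only [← rpow_natCast, ← rpow_mul hT0.le]
        rw [← rpow_one_add' hT0.le (by positivity), ← rpow_add hT0, ← rpow_add hT0,
          ← rpow_add hT0]
        congr 1
        have hηε : η * (2 * p + 1) = ε := div_mul_cancel₀ _ (by positivity)
        have hpk : (p : ℝ) = 2 * (k + 1) := by rw [hp]; push_cast; ring
        push_cast
        linear_combination hηε + 9 / 8 * hpk
end
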